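/- arXiv:2602.11331 — 2 statements merged into one kernel-verified Lean document; each statement's English description precedes it below -/
import Mathlib

section
/- A finite connected simple graph G of diameter 2 has second largest distance eigenvalue λ2(G) < −1/2 if and only if G is isomorphic to a connected induced subgraph of a relaxed block star, i.e., of a graph of the form K_1 ⊕ ((p_1 K_{r_1} ∪ ⋯ ∪ p_k K_{r_k}) ∪ q(K_1 ⊕ (K_1 ∪ K_2)) ∪ s P_3) for some positive integers k, p_1, …, p_k, r_1, …, r_k, q, s. -/
open Polynomial SimpleGraph Sum

noncomputable section

/-- The distance matrix of a graph, with real entries. -/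
def distMatrix {V : Type*} [Fintype V] (G : SimpleGraph V) : Matrix V V ℝ :=
  Matrix.of fun u v => (G.dist u v : ℝ)

/-- The second largest distance eigenvalue: the eigenvalues of the distance matrix
(the roots of its characteristic polynomial, with multiplicity) are sorted in
increasing order, and we take the one at position `card V - 2`. -/
def lambda2 {V : Type*} [Fintype V] [DecidableEq V] (G : SimpleGraph V) : ℝ :=
  ((distMatrix G).charpoly.roots.sort (· ≤ ·)).getD (Fintype.card V - 2) 0

/-- The diameter of a finite graph. -/
def graphDiam {V : Type*} [Fintype V] (G : SimpleGraph V) : ℕ :=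
  Finset.univ.sup fun p : V × V => G.dist p.1 p.2

/-- A graph is chordal if every cycle of length at least 4 has a chord. -/
def IsChordal {V : Type*} (G : SimpleGraph V) : Prop :=
  ∀ (v : V) (c : G.Walk v v), c.IsCycle → 4 ≤ c.length →
    ∃ u w : V, u ∈ c.support ∧ w ∈ c.support ∧ G.Adj u w ∧ s(u, w) ∉ c.edges

/-- Ptolemaic graph: the Ptolemy inequality for the graph distance. -/
def IsPtolemaic {V : Type*} (G : SimpleGraph V) : Prop :=
  ∀ u v w x : V,
    G.dist u v * G.dist w x ≤ G.dist u w * G.dist v x + G.dist u x * G.dist v w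

/-- `S` is a `uv`-separator: `u, v ∉ S` and every walk from `u` to `v` meets `S`. -/
def IsUVSeparator {V : Type*} (G : SimpleGraph V) (S : Finset V) (u v : V) : Prop :=
  u ∉ S ∧ v ∉ S ∧ ∀ w : G.Walk u v, ∃ x ∈ w.support, x ∈ S

/-- `S` is a minimal vertex separator: a minimal `uv`-separator for some pair of
distinct non-adjacent vertices `u, v`. -/
def IsMinimalVertexSeparator {V : Type*} (G : SimpleGraph V) (S : Finset V) : Prop :=
  ∃ u v : V, u ≠ v ∧ ¬ G.Adj u v ∧ IsUVSeparator G S u v ∧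
    ∀ T : Finset V, T ⊂ S → ¬ IsUVSeparator G T u v

/-- A connected component `K` of `G − S` is full if every vertex of `S` has a
neighbour in `K`. -/
def IsFullComponent {V : Type*} (G : SimpleGraph V) (S : Finset V)
    (K : (G.induce ((S : Set V)ᶜ)).ConnectedComponent) : Prop :=
  ∀ a ∈ S, ∃ x : ((S : Set V)ᶜ : Set V),
    (G.induce ((S : Set V)ᶜ)).connectedComponentMk x = K ∧ G.Adj a ↑x

/-- The join `G ⊕ H` of two vertex-disjoint graphs. -/
def graphJoin {α β : Type*} (G : SimpleGraph α) (H : SimpleGraph β) :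
    SimpleGraph (α ⊕ β) :=
  SimpleGraph.fromRel fun x y =>
    (∃ a b, x = Sum.inl a ∧ y = Sum.inl b ∧ G.Adj a b) ∨
    (∃ a b, x = Sum.inr a ∧ y = Sum.inr b ∧ H.Adj a b) ∨
    (x.isLeft ∧ y.isRight)

/-- The disjoint union of two vertex-disjoint graphs. -/
def graphSum {α β : Type*} (G : SimpleGraph α) (H : SimpleGraph β) :
    SimpleGraph (α ⊕ β) :=
  SimpleGraph.fromRel fun x y =>
    (∃ a b, x = Sum.inl a ∧ y = Sum.inl b ∧ G.Adj a b) ∨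
    (∃ a b, x = Sum.inr a ∧ y = Sum.inr b ∧ H.Adj a b)

/-- `p` disjoint copies of the complete graph `K_r`. -/
def cliqueCopies (p r : ℕ) : SimpleGraph (Fin p × Fin r) :=
  SimpleGraph.fromRel fun x y => x.1 = y.1

/-- `q` disjoint copies of `K_1 ⊕ (K_1 ∪ K_2)` (the paw graph): in each copy,
vertex 0 is universal, vertex 1 is otherwise isolated, vertices 2,3 form a `K_2`. -/
def pawCopies (q : ℕ) : SimpleGraph (Fin q × Fin 4) :=
  SimpleGraph.fromRel fun x y => x.1 = y.1 ∧ (x.2 = 0 ∨ (x.2 = 2 ∧ y.2 = 3))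

/-- `s` disjoint copies of the path `P_3`. -/
def path3Copies (s : ℕ) : SimpleGraph (Fin s × Fin 3) :=
  SimpleGraph.fromRel fun x y => x.1 = y.1 ∧ ((x.2 = 0 ∧ y.2 = 1) ∨ (x.2 = 1 ∧ y.2 = 2))

/-- The disjoint union `p_1 K_{r_1} ∪ ⋯ ∪ p_k K_{r_k}`. -/
def multiCliques (k : ℕ) (p r : Fin k → ℕ) :
    SimpleGraph ((i : Fin k) × (Fin (p i) × Fin (r i))) :=
  SimpleGraph.fromRel fun x y =>
    (⟨x.1, x.2.1⟩ : (i : Fin k) × Fin (p i)) = ⟨y.1, y.2.1⟩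

/-- The relaxed block star
`K_1 ⊕ ((p_1 K_{r_1} ∪ ⋯ ∪ p_k K_{r_k}) ∪ q (K_1 ⊕ (K_1 ∪ K_2)) ∪ s P_3)`. -/
def relaxedBlockStar (k : ℕ) (p r : Fin k → ℕ) (q s : ℕ) :
    SimpleGraph (Unit ⊕ (((i : Fin k) × (Fin (p i) × Fin (r i))) ⊕
      ((Fin q × Fin 4) ⊕ (Fin s × Fin 3)))) :=
  graphJoin (⊤ : SimpleGraph Unit)
    (graphSum (multiCliques k p r) (graphSum (pawCopies q) (path3Copies s)))

/-- The graph `G(r,p,q) = K_1 ⊕ (p K_r ∪ q (K_1 ⊕ (K_1 ∪ K_2)))`. -/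
def Grpq (r p q : ℕ) : SimpleGraph (Unit ⊕ ((Fin p × Fin r) ⊕ (Fin q × Fin 4))) :=
  graphJoin (⊤ : SimpleGraph Unit) (graphSum (cliqueCopies p r) (pawCopies q))

/-- The full house graph `K_2 ⊕ (K_1 ∪ K_2)`: vertices 0,1 form the join-`K_2`,
vertex 2 is the `K_1`, vertices 3,4 form the `K_2`. -/
def fullHouse : SimpleGraph (Fin 5) :=
  SimpleGraph.fromRel fun x y => x = 0 ∨ x = 1 ∨ (x = 3 ∧ y = 4)

/-- The diamond graph: `K_4` minus an edge. -/
def diamondGraph : SimpleGraph (Fin 4) :=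
  SimpleGraph.fromRel fun x y => x = 0 ∨ x = 1

/-- The path on four vertices. -/
def path4 : SimpleGraph (Fin 4) :=
  SimpleGraph.fromRel fun x y => (x : ℕ) + 1 = (y : ℕ)

/-- The cycle on four vertices. -/
def cycle4 : SimpleGraph (Fin 4) :=
  SimpleGraph.fromRel fun x y => x + 1 = y

/-- The triple block graph `Pt_2(p,q)`: a full house (on `Fin 5`, with the
join-`K_2` being vertices `a = 0`, `b = 1`) together with `p - 1` further vertices
forming with `a` a clique `K_p` and `q - 1` further vertices forming with `b`
a clique `K_q`. -/
def Pt2Graph (p q : ℕ) : SimpleGraph (Fin 5 ⊕ (Fin (p - 1) ⊕ Fin (q - 1))) :=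
  SimpleGraph.fromRel fun x y =>
    match x, y with
    | Sum.inl a, Sum.inl b => a = 0 ∨ a = 1 ∨ (a = 3 ∧ b = 4)
    | Sum.inl a, Sum.inr (Sum.inl _) => a = 0
    | Sum.inl a, Sum.inr (Sum.inr _) => a = 1
    | Sum.inr (Sum.inl _), Sum.inr (Sum.inl _) => True
    | Sum.inr (Sum.inr _), Sum.inr (Sum.inr _) => True
    | _, _ => False

/-- The nine-vertex graph `Pt_1`: a full house (vertices 0,…,4, join-`K_2` being
`a = 0`, `b = 1`, `K_2` being 3,4), a vertex 5 adjacent only to `a`, a vertex 6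
adjacent only to `b`, and vertices 7,8 adjacent to each other and to `b`. -/
def Pt1Graph : SimpleGraph (Fin 9) :=
  SimpleGraph.fromRel fun x y =>
    (x = 0 ∧ (y = 1 ∨ y = 2 ∨ y = 3 ∨ y = 4 ∨ y = 5)) ∨
    (x = 1 ∧ (y = 2 ∨ y = 3 ∨ y = 4 ∨ y = 6 ∨ y = 7 ∨ y = 8)) ∨
    (x = 3 ∧ y = 4) ∨ (x = 7 ∧ y = 8)

/-- `G` contains an induced subgraph isomorphic to `H`. -/
def HasInducedSubgraph {V W : Type*} (G : SimpleGraph V) (H : SimpleGraph W) : Prop :=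
  ∃ s : Set V, Nonempty ((G.induce s) ≃g H)

/-- `G` is isomorphic to a connected induced subgraph of `H`. -/
def IsoToConnectedInducedSubgraph {V W : Type*} (G : SimpleGraph V)
    (H : SimpleGraph W) : Prop :=
  ∃ s : Set W, (H.induce s).Connected ∧ Nonempty (G ≃g (H.induce s))

/-- A vertex is simplicial if its neighbourhood is a clique. -/
def IsSimplicial {V : Type*} (G : SimpleGraph V) (v : V) : Prop :=
  G.IsClique (G.neighborSet v)

/-- The quintic polynomial `f(r,p,q,x)`. -/
def fpoly (r p q : ℕ) : Polynomial ℝ :=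
  X ^ 5 - C (8 * (q : ℝ) + 2 * (r : ℝ) * (p : ℝ) - (r : ℝ) - 8) * X ^ 4
    - C ((8 * (r : ℝ) + 36) * (q : ℝ) + 15 * (r : ℝ) * (p : ℝ) - 7 * (r : ℝ) - 20) * X ^ 3
    - C ((28 * (r : ℝ) + 52) * (q : ℝ) + 33 * (r : ℝ) * (p : ℝ) - 13 * (r : ℝ) - 18) * X ^ 2
    - C ((24 * (r : ℝ) + 30) * (q : ℝ) + 23 * (r : ℝ) * (p : ℝ) - 5 * (r : ℝ) - 5) * X
    - C ((6 * (r : ℝ) + 6) * (q : ℝ) + 5 * (r : ℝ) * (p : ℝ))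

end

theorem Matrix.IsHermitian.dotProduct_mulVec_eq_sum {V : Type*} [Fintype V] [DecidableEq V]
    {M : Matrix V V ℝ} (hM : M.IsHermitian) (x : V → ℝ) :
    x ⬝ᵥ M.mulVec x = ∑ i, hM.eigenvalues i *
      ((star (hM.eigenvectorUnitary : Matrix V V ℝ)).mulVec x i) ^ 2 := by
  conv_lhs => rw [hM.spectral_theorem, Unitary.conjStarAlgAut_apply]
  rw [← Matrix.mulVec_mulVec, ← Matrix.mulVec_mulVec, Matrix.dotProduct_mulVec,
    ← Matrix.mulVec_transpose]
  have : (hM.eigenvectorUnitary : Matrix V V ℝ).transpose =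
      star (hM.eigenvectorUnitary : Matrix V V ℝ) := by
    rw [Matrix.star_eq_conjTranspose, Matrix.conjTranspose_eq_transpose_of_trivial]
  rw [this]
  simp only [dotProduct, Matrix.mulVec_diagonal]
  refine Finset.sum_congr rfl fun i _ => ?_
  simp; ring

theorem Matrix.dotProduct_self_star_unitary_mulVec {V : Type*} [Fintype V] [DecidableEq V]
    (U : Matrix.unitaryGroup V ℝ) (x : V → ℝ) :
    ∑ i, ((star (U : Matrix V V ℝ)).mulVec x i) ^ 2 = x ⬝ᵥ x := by
  have h : (U : Matrix V V ℝ).transpose = star (U : Matrix V V ℝ) := by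
    rw [Matrix.star_eq_conjTranspose, Matrix.conjTranspose_eq_transpose_of_trivial]
  calc _ = (star (U : Matrix V V ℝ)).mulVec x ⬝ᵥ (star (U : Matrix V V ℝ)).mulVec x := by
        simp [dotProduct, sq]
    _ = x ⬝ᵥ ((U : Matrix V V ℝ) * star (U : Matrix V V ℝ)).mulVec x := by
        rw [← Matrix.mulVec_mulVec, Matrix.dotProduct_mulVec x, ← Matrix.mulVec_transpose, h]
    _ = x ⬝ᵥ x := by simp

/-- Courant–Fischer for the second largest eigenvalue. -/
theorem Matrix.IsHermitian.sort_roots_getD_lt_iff {V : Type*} [Fintype V] [DecidableEq V]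
    {M : Matrix V V ℝ} (hM : M.IsHermitian) (hV : 2 ≤ Fintype.card V) (t : ℝ) :
    (M.charpoly.roots.sort (· ≤ ·)).getD (Fintype.card V - 2) 0 < t ↔
      ∃ w : V → ℝ, ∀ x : V → ℝ, x ≠ 0 → w ⬝ᵥ x = 0 → x ⬝ᵥ M.mulVec x < t * (x ⬝ᵥ x) := by
  have hroots : M.charpoly.roots.sort (· ≤ ·) = (List.ofFn hM.eigenvalues₀).reverse := by
    apply List.Perm.eq_of_pairwise' (r := (· ≤ ·))
    · exact Multiset.pairwise_sort _ _
    · rw [List.pairwise_reverse]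
      exact (hM.eigenvalues₀_antitone.sortedGE_ofFn).pairwise
    · rw [← Multiset.coe_eq_coe, Multiset.sort_eq, hM.roots_charpoly_eq_eigenvalues₀,
        Multiset.coe_reverse, Fin.univ_val_map]
      rfl
  set σ : Fin (Fintype.card V) ≃ V := Fintype.equivOfCardEq (Fintype.card_fin _) with hσ
  have hev : ∀ k, hM.eigenvalues (σ k) = hM.eigenvalues₀ k := fun k => by
    simp [Matrix.IsHermitian.eigenvalues, hσ]
  have hval : (M.charpoly.roots.sort (· ≤ ·)).getD (Fintype.card V - 2) 0 =
      hM.eigenvalues (σ ⟨1, hV⟩) := by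
    rw [hroots, hev, List.getD_eq_getElem _ _ (by simp; omega)]
    simp only [List.getElem_reverse, List.length_ofFn, List.getElem_ofFn]
    congr 2
    omega
  rw [hval]
  set U := hM.eigenvectorUnitary
  set L : (V → ℝ) → V → ℝ := fun x => (star (U : Matrix V V ℝ)).mulVec x with hL
  have hinv : ∀ y, L ((U : Matrix V V ℝ).mulVec y) = y := by
    intro y
    simp [hL, Matrix.mulVec_mulVec]
  have hform : ∀ x, x ⬝ᵥ M.mulVec x - t * (x ⬝ᵥ x) = ∑ i, (hM.eigenvalues i - t) * L x i ^ 2 := by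
    intro x
    rw [hM.dotProduct_mulVec_eq_sum, ← Matrix.dotProduct_self_star_unitary_mulVec U x,
      Finset.mul_sum, ← Finset.sum_sub_distrib]
    exact Finset.sum_congr rfl fun i _ => by rw [sub_mul]
  have h01 : σ ⟨0, by omega⟩ ≠ σ ⟨1, hV⟩ := by simp
  constructor
  · intro ht
    refine ⟨fun j => star (U : Matrix V V ℝ) (σ ⟨0, by omega⟩) j, fun x hx hwx => ?_⟩
    rw [← sub_neg, hform]
    have h0 : L x (σ ⟨0, by omega⟩) = 0 := hwx
    have hlt : ∀ i, i ≠ σ ⟨0, by omega⟩ → hM.eigenvalues i - t < 0 := by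
      intro i hi
      obtain ⟨k, rfl⟩ := σ.surjective i
      have : (⟨1, hV⟩ : Fin (Fintype.card V)) ≤ k := by
        rw [Fin.le_def]
        by_contra hk
        exact hi (congrArg σ (Fin.ext (by simp at hk ⊢; omega)))
      have := hM.eigenvalues₀_antitone this
      rw [hev] at ht ⊢
      linarith
    have hex : ∃ i, L x i ≠ 0 := by
      by_contra! hall
      apply hx
      have hLx : L x = 0 := funext hall
      have := congrArg ((U : Matrix V V ℝ).mulVec) hLx
      simpa [hL, Matrix.mulVec_mulVec] using this
    obtain ⟨i, hi⟩ := hex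
    refine Finset.sum_neg' (fun j _ => ?_) ⟨i, Finset.mem_univ i, ?_⟩
    · by_cases hj : j = σ ⟨0, by omega⟩
      · rw [hj, h0]; simp
      · exact mul_nonpos_of_nonpos_of_nonneg (hlt j hj).le (sq_nonneg _)
    · have hi0 : i ≠ σ ⟨0, by omega⟩ := fun h => hi (h ▸ h0)
      exact mul_neg_of_neg_of_pos (hlt i hi0) (by positivity)
  · rintro ⟨w, hw⟩
    by_contra! ht
    set i₀ := σ ⟨0, by omega⟩
    set i₁ := σ ⟨1, hV⟩
    have ht0 : t ≤ hM.eigenvalues i₀ := by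
      refine ht.trans ?_
      rw [hev, hev]
      exact hM.eigenvalues₀_antitone (by simp [Fin.le_def])
    obtain ⟨a, b, hab, hz⟩ : ∃ a b : ℝ, (a ≠ 0 ∨ b ≠ 0) ∧
        w ⬝ᵥ (U : Matrix V V ℝ).mulVec (a • Pi.single i₀ 1 + b • Pi.single i₁ 1) = 0 := by
      set α := w ⬝ᵥ (U : Matrix V V ℝ).mulVec (Pi.single i₀ 1) with hα
      set β := w ⬝ᵥ (U : Matrix V V ℝ).mulVec (Pi.single i₁ 1) with hβ
      have key : ∀ a b : ℝ, w ⬝ᵥ (U : Matrix V V ℝ).mulVec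
          (a • Pi.single i₀ 1 + b • Pi.single i₁ 1) = a * α + b * β := fun a b => by
        rw [Matrix.mulVec_add, Matrix.mulVec_smul, Matrix.mulVec_smul, dotProduct_add,
          dotProduct_smul, dotProduct_smul, smul_eq_mul, smul_eq_mul]
      by_cases hα0 : α = 0
      · exact ⟨1, 0, by simp, by rw [key, hα0]; ring⟩
      · exact ⟨-β, α, Or.inr hα0, by rw [key]; ring⟩
    set y : V → ℝ := a • Pi.single i₀ 1 + b • Pi.single i₁ 1 with hy
    have hy0 : y i₀ = a := by simp [hy, h01]
    have hy1 : y i₁ = b := by simp [hy, h01.symm]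
    have hyo : ∀ i, i ≠ i₀ → i ≠ i₁ → y i = 0 := fun i h h' => by simp [hy, h, h']
    have hne : (U : Matrix V V ℝ).mulVec y ≠ 0 := by
      intro h
      have hy' : y = 0 := by rw [← hinv y, h]; simp [hL]
      rcases hab with h | h
      · exact h (by rw [← hy0, hy']; rfl)
      · exact h (by rw [← hy1, hy']; rfl)
    have := hw _ hne hz
    rw [← sub_neg, hform, hinv] at this
    refine absurd this (not_lt.mpr (Finset.sum_nonneg fun i _ => ?_))
    by_cases hi0 : i = i₀
    · exact mul_nonneg (by rw [hi0]; linarith) (sq_nonneg _)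
    by_cases hi1 : i = i₁
    · exact mul_nonneg (by rw [hi1]; linarith) (sq_nonneg _)
    · rw [hyo i hi0 hi1]; simp

open Classical in
/-- The entries of `A(G) + 3/2`, where `A(G)` is the adjacency matrix. -/
noncomputable def shiftEntry {V : Type*} (G : SimpleGraph V) (u v : V) : ℝ :=
  if u = v then 3 / 2 else if G.Adj u v then 1 else 0

/-- The quadratic form of `A(G) + 3/2`. -/
noncomputable def shiftForm {V : Type*} [Fintype V] (G : SimpleGraph V) (x : V → ℝ) : ℝ :=
  ∑ u, ∑ v, x u * x v * shiftEntry G u v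

/-- `A(G) + 3/2` is positive definite. -/
def ShiftPos {V : Type*} [Fintype V] (G : SimpleGraph V) : Prop :=
  ∀ x : V → ℝ, x ≠ 0 → 0 < shiftForm G x

/-- The form of `2J - (A(G) + 3/2)` is negative definite on some hyperplane. -/
def NegOnHyperplane {V : Type*} [Fintype V] (G : SimpleGraph V) : Prop :=
  ∃ w : V → ℝ, ∀ x : V → ℝ, x ≠ 0 → w ⬝ᵥ x = 0 → 2 * (∑ u, x u) ^ 2 < shiftForm G x

theorem shiftEntry_congr {V W : Type*} {G : SimpleGraph V} {H : SimpleGraph W} {u v : V}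
    {u' v' : W} (heq : u = v ↔ u' = v') (hadj : G.Adj u v ↔ H.Adj u' v') :
    shiftEntry G u v = shiftEntry H u' v' := by
  unfold shiftEntry
  by_cases h : u = v <;> by_cases h' : G.Adj u v
  all_goals simp only [h, ← heq, ← hadj, h', if_true, if_false]

theorem shiftEntry_embedding {V W : Type*} {G : SimpleGraph V} {H : SimpleGraph W}
    (f : G ↪g H) (u v : V) : shiftEntry H (f u) (f v) = shiftEntry G u v :=
  shiftEntry_congr f.injective.eq_iff f.map_adj_iff

theorem sum_extend_mul {V W : Type*} [Fintype V] [Fintype W] {f : V → W}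
    (hf : Function.Injective f) (x : V → ℝ) (c : W → ℝ) :
    ∑ w, Function.extend f x 0 w * c w = ∑ v, x v * c (f v) := by
  symm
  refine Fintype.sum_of_injective f hf _ _ (fun w hw => ?_) fun v => ?_
  · rw [Function.extend_apply' _ _ _ fun ⟨v, hv⟩ => hw ⟨v, hv⟩]
    simp
  · rw [hf.extend_apply]

theorem shiftForm_extend {V W : Type*} [Fintype V] [Fintype W] {G : SimpleGraph V}
    {H : SimpleGraph W} (f : G ↪g H) (x : V → ℝ) :
    shiftForm H (Function.extend f x 0) = shiftForm G x := by
  simp only [shiftForm, mul_assoc, ← Finset.mul_sum, sum_extend_mul f.injective,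
    shiftEntry_embedding]

theorem extend_ne_zero {V W : Type*} {f : V → W} (hf : Function.Injective f) {x : V → ℝ}
    (hx : x ≠ 0) : Function.extend f x 0 ≠ 0 := by
  intro h
  refine hx (funext fun v => ?_)
  rw [← hf.extend_apply x 0 v, h]
  rfl

theorem ShiftPos.of_embedding {V W : Type*} [Fintype V] [Fintype W] {G : SimpleGraph V}
    {H : SimpleGraph W} (hH : ShiftPos H) (f : G ↪g H) : ShiftPos G := fun x hx => by
  rw [← shiftForm_extend f]
  exact hH _ (extend_ne_zero f.injective hx)

theorem NegOnHyperplane.of_embedding {V W : Type*} [Fintype V] [Fintype W] {G : SimpleGraph V}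
    {H : SimpleGraph W} (hH : NegOnHyperplane H) (f : G ↪g H) : NegOnHyperplane G := by
  obtain ⟨w, hw⟩ := hH
  refine ⟨w ∘ f, fun x hx hwx => ?_⟩
  have hsum : ∑ u, Function.extend f x 0 u = ∑ v, x v := by
    simpa using sum_extend_mul f.injective x fun _ => 1
  rw [← shiftForm_extend f, ← hsum]
  refine hw _ (extend_ne_zero f.injective hx) ?_
  rw [dotProduct_comm, dotProduct, sum_extend_mul f.injective, ← hwx, dotProduct_comm]
  rfl

/-- Two independent vectors cannot span a plane on which `2J - (A(G) + 3/2)` is nonnegative. -/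
theorem NegOnHyperplane.exists_lt {V : Type*} [Fintype V] {G : SimpleGraph V}
    (hG : NegOnHyperplane G) (x y : V → ℝ)
    (hxy : ∀ a b : ℝ, a • x + b • y = 0 → a = 0 ∧ b = 0) :
    ∃ a b : ℝ, 2 * (∑ u, (a • x + b • y) u) ^ 2 < shiftForm G (a • x + b • y) := by
  obtain ⟨w, hw⟩ := hG
  have key : ∀ a b : ℝ, w ⬝ᵥ (a • x + b • y) = a * (w ⬝ᵥ x) + b * (w ⬝ᵥ y) := fun a b => by
    rw [dotProduct_add, dotProduct_smul, dotProduct_smul, smul_eq_mul, smul_eq_mul]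
  by_cases hx : w ⬝ᵥ x = 0
  · exact ⟨1, 0, hw _ (fun h => one_ne_zero (hxy _ _ h).1) (by rw [key, hx]; ring)⟩
  · exact ⟨-(w ⬝ᵥ y), w ⬝ᵥ x, hw _ (fun h => hx (hxy _ _ h).2) (by rw [key]; ring)⟩

theorem lambda2_lt_iff_negOnHyperplane {V : Type*} [Fintype V] [DecidableEq V]
    (G : SimpleGraph V) (hconn : G.Connected) (hdiam : graphDiam G = 2) :
    lambda2 G < -1 / 2 ↔ NegOnHyperplane G := by
  have hle : ∀ u v, G.dist u v ≤ 2 := fun u v => by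
    rw [← hdiam]
    exact Finset.le_sup (f := fun p : V × V => G.dist p.1 p.2) (Finset.mem_univ (u, v))
  have hcard : 2 ≤ Fintype.card V := by
    by_contra! h
    have : Subsingleton V := Fintype.card_le_one_iff_subsingleton.mp (by omega)
    have h0 : graphDiam G ≤ 0 := Finset.sup_le fun p _ => by
      rw [Subsingleton.elim p.1 p.2, SimpleGraph.dist_self]
    omega
  have hM : (distMatrix G).IsHermitian := by
    ext u v
    simp [distMatrix, SimpleGraph.dist_comm]
  have hentry : ∀ u v, (G.dist u v : ℝ) = 2 - shiftEntry G u v - if u = v then 1 / 2 else 0 := by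
    intro u v
    by_cases huv : u = v
    · subst huv
      simp [shiftEntry]
      norm_num
    by_cases hadj : G.Adj u v
    · simp [shiftEntry, huv, hadj, SimpleGraph.dist_eq_one_iff_adj.mpr hadj]
      norm_num
    · have h0 := (hconn u v).pos_dist_of_ne huv
      have h1 : G.dist u v ≠ 1 := fun h => hadj (SimpleGraph.dist_eq_one_iff_adj.mp h)
      have h2 := hle u v
      have : G.dist u v = 2 := by omega
      simp [shiftEntry, huv, hadj, this]
  have hform : ∀ x : V → ℝ, x ⬝ᵥ (distMatrix G).mulVec x =
      2 * (∑ u, x u) ^ 2 - shiftForm G x - 1 / 2 * (x ⬝ᵥ x) := by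
    intro x
    have hsq : 2 * (∑ u, x u) ^ 2 = ∑ u, ∑ v, x u * x v * 2 := by
      rw [sq, Finset.sum_mul_sum, Finset.mul_sum]
      refine Finset.sum_congr rfl fun u _ => ?_
      rw [Finset.mul_sum]
      exact Finset.sum_congr rfl fun v _ => by ring
    have hdiag : 1 / 2 * (x ⬝ᵥ x) = ∑ u, ∑ v, x u * x v * if u = v then 1 / 2 else 0 := by
      simp only [mul_ite, mul_zero, Finset.sum_ite_eq, Finset.mem_univ, if_true, dotProduct,
        Finset.mul_sum]
      exact Finset.sum_congr rfl fun u _ => by ring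
    rw [hsq, hdiag, shiftForm, ← Finset.sum_sub_distrib, ← Finset.sum_sub_distrib]
    refine Finset.sum_congr rfl fun u _ => ?_
    rw [← Finset.sum_sub_distrib, ← Finset.sum_sub_distrib, Matrix.mulVec, dotProduct,
      Finset.mul_sum]
    refine Finset.sum_congr rfl fun v _ => ?_
    rw [distMatrix, Matrix.of_apply, hentry]
    ring
  rw [lambda2, hM.sort_roots_getD_lt_iff hcard, NegOnHyperplane]
  refine exists_congr fun w => forall_congr' fun x => imp_congr_right fun _ =>
    imp_congr_right fun _ => ?_
  rw [hform]
  constructor <;> intro h <;> linarith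

section Adjacency

variable {V W : Type*}

theorem graphJoin_adj_inr (G : SimpleGraph V) (H : SimpleGraph W) {w z : W} :
    (graphJoin G H).Adj (inr w) (inr z) ↔ H.Adj w z := by
  simpa [graphJoin, SimpleGraph.adj_comm H z w] using H.ne_of_adj

theorem graphSum_adj_inl (G : SimpleGraph V) (H : SimpleGraph W) {u v : V} :
    (graphSum G H).Adj (inl u) (inl v) ↔ G.Adj u v := by
  simpa [graphSum, SimpleGraph.adj_comm G v u] using G.ne_of_adj

theorem graphSum_adj_inr (G : SimpleGraph V) (H : SimpleGraph W) {w z : W} :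
    (graphSum G H).Adj (inr w) (inr z) ↔ H.Adj w z := by
  simpa [graphSum, SimpleGraph.adj_comm H z w] using H.ne_of_adj

end Adjacency

section Join

variable {W : Type*} [Fintype W]

theorem shiftForm_graphJoin_top (H : SimpleGraph W) (x : Unit ⊕ W → ℝ) :
    shiftForm (graphJoin (⊤ : SimpleGraph Unit) H) x =
      3 / 2 * x (inl ()) ^ 2 + 2 * x (inl ()) * ∑ w, x (inr w) + shiftForm H (x ∘ inr) := by
  have h1 : ∀ w, shiftEntry (graphJoin (⊤ : SimpleGraph Unit) H) (inl ()) (inr w) = 1 := by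
    simp [shiftEntry, graphJoin]
  have h2 : ∀ w, shiftEntry (graphJoin (⊤ : SimpleGraph Unit) H) (inr w) (inl ()) = 1 := by
    simp [shiftEntry, graphJoin]
  have h3 : ∀ w z, shiftEntry (graphJoin (⊤ : SimpleGraph Unit) H) (inr w) (inr z) =
      shiftEntry H w z := fun w z =>
    shiftEntry_congr inr_injective.eq_iff (graphJoin_adj_inr _ _)
  have h0 : shiftEntry (graphJoin (⊤ : SimpleGraph Unit) H) (inl ()) (inl ()) = 3 / 2 := by
    simp [shiftEntry]
  simp only [shiftForm, Fintype.sum_sum_type, Finset.univ_unique, Finset.sum_singleton,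
    PUnit.default_eq_unit, h0, h1, h2, h3, mul_one, Finset.sum_add_distrib, ← Finset.mul_sum,
    ← Finset.sum_mul, Function.comp_apply]
  ring

theorem negOnHyperplane_graphJoin_top_iff (H : SimpleGraph W) :
    NegOnHyperplane (graphJoin (⊤ : SimpleGraph Unit) H) ↔ ShiftPos H := by
  constructor
  · intro h y hy
    set s := ∑ w, y w with hs
    by_contra! hq
    obtain ⟨a, b, hab⟩ := h.exists_lt (Sum.elim (fun _ => -2 * s) y)
      (Sum.elim (fun _ => 1) fun _ => 0) (by
        intro a b hab
        obtain ⟨w, hw⟩ := Function.ne_iff.mp hy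
        have ha : a = 0 := by
          have := congrFun hab (inr w)
          simpa [show y w ≠ 0 from hw] using this
        refine ⟨ha, ?_⟩
        have := congrFun hab (inl ())
        simpa [ha] using this)
    have hcomp : (a • (Sum.elim (fun _ => -2 * s) y : Unit ⊕ W → ℝ) +
        b • (Sum.elim (fun _ => 1) fun _ => 0)) ∘ inr = a • y := by
      ext w; simp
    have hsmul : shiftForm H (a • y) = a ^ 2 * shiftForm H y := by
      simp only [shiftForm, Finset.mul_sum, Pi.smul_apply, smul_eq_mul]
      exact Finset.sum_congr rfl fun _ _ => Finset.sum_congr rfl fun _ _ => by ring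
    rw [shiftForm_graphJoin_top, hcomp, hsmul] at hab
    simp only [Fintype.sum_sum_type, Finset.univ_unique, Finset.sum_singleton, Pi.add_apply,
      Pi.smul_apply, Sum.elim_inl, Sum.elim_inr, smul_eq_mul, mul_zero, add_zero, mul_one,
      ← Finset.mul_sum, ← hs] at hab
    nlinarith [mul_nonneg (sq_nonneg a) (neg_nonneg.mpr hq), sq_nonneg b]
  · intro h
    refine ⟨Sum.elim (fun _ => 1) fun _ => 2, fun x hx hwx => ?_⟩
    have hx0 : x (inl ()) = -2 * ∑ w, x (inr w) := by
      simp only [dotProduct, Fintype.sum_sum_type, Finset.univ_unique, Finset.sum_singleton,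
        Sum.elim_inl, Sum.elim_inr, ← Finset.mul_sum, PUnit.default_eq_unit] at hwx
      linarith
    have hy : x ∘ inr ≠ 0 := by
      intro hy
      have hy' : ∀ w, x (inr w) = 0 := fun w => congrFun hy w
      refine hx (funext fun z => ?_)
      rcases z with ⟨⟩ | w
      · simpa [hy'] using hx0
      · exact hy' w
    have := h _ hy
    rw [shiftForm_graphJoin_top]
    simp only [Fintype.sum_sum_type, Finset.univ_unique, Finset.sum_singleton,
      PUnit.default_eq_unit, hx0]
    nlinarith

end Join

section BlockStar

theorem shiftForm_zero {V : Type*} [Fintype V] (G : SimpleGraph V) :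
    shiftForm G (0 : V → ℝ) = 0 := by
  simp [shiftForm]

theorem shiftPos_graphSum {V W : Type*} [Fintype V] [Fintype W] {G : SimpleGraph V}
    {H : SimpleGraph W} (hG : ShiftPos G) (hH : ShiftPos H) : ShiftPos (graphSum G H) := by
  intro x hx
  have h1 : ∀ w z, shiftEntry (graphSum G H) (inl w) (inl z) = shiftEntry G w z :=
    fun w z => shiftEntry_congr inl_injective.eq_iff (graphSum_adj_inl _ _)
  have h2 : ∀ w z, shiftEntry (graphSum G H) (inr w) (inr z) = shiftEntry H w z :=
    fun w z => shiftEntry_congr inr_injective.eq_iff (graphSum_adj_inr _ _)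
  have h3 : ∀ w z, shiftEntry (graphSum G H) (inl w) (inr z) = 0 := by
    simp [shiftEntry, graphSum]
  have h4 : ∀ w z, shiftEntry (graphSum G H) (inr w) (inl z) = 0 := by
    simp [shiftEntry, graphSum]
  have hform : shiftForm (graphSum G H) x =
      shiftForm G (x ∘ inl) + shiftForm H (x ∘ inr) := by
    simp [shiftForm, Fintype.sum_sum_type, h1, h2, h3, h4]
  rw [hform]
  by_cases hl : x ∘ inl = 0
  · have hr : x ∘ inr ≠ 0 := by
      intro hr
      refine hx (funext fun z => ?_)
      rcases z with v | w
      · exact congrFun hl v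
      · exact congrFun hr w
    rw [hl, shiftForm_zero, zero_add]
    exact hH _ hr
  · by_cases hr : x ∘ inr = 0
    · rw [hr, shiftForm_zero, add_zero]
      exact hG _ hl
    · exact add_pos (hG _ hl) (hH _ hr)

/-- Disjoint unions of complete graphs. -/
theorem shiftPos_of_adj_iff {V β : Type*} [Fintype V] [Fintype β] (b : V → β)
    {G : SimpleGraph V} (hG : ∀ u v, G.Adj u v ↔ u ≠ v ∧ b u = b v) : ShiftPos G := by
  classical
  intro x hx
  have hentry : ∀ u v, shiftEntry G u v =
      (∑ i, (if b u = i then 1 else 0) * if b v = i then 1 else 0) +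
        if u = v then 1 / 2 else 0 := by
    intro u v
    by_cases h : u = v
    · simp [shiftEntry, h]; norm_num
    · simp [shiftEntry, hG, h, eq_comm]
  have hform : shiftForm G x =
      (∑ i, (∑ u, x u * if b u = i then 1 else 0) ^ 2) + ∑ u, 1 / 2 * x u ^ 2 := by
    have hsq : ∀ i, (∑ u, x u * if b u = i then (1 : ℝ) else 0) ^ 2 =
        ∑ u, ∑ v, x u * x v * ((if b u = i then 1 else 0) * if b v = i then 1 else 0) := by
      intro i
      rw [sq, Finset.sum_mul_sum]
      exact Finset.sum_congr rfl fun u _ => Finset.sum_congr rfl fun v _ => by ring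
    simp only [hsq]
    rw [Finset.sum_comm, ← Finset.sum_add_distrib, shiftForm]
    refine Finset.sum_congr rfl fun u _ => ?_
    rw [Finset.sum_comm]
    simp only [hentry, mul_add, Finset.sum_add_distrib, Finset.mul_sum]
    congr 1
    simp
    ring
  rw [hform]
  obtain ⟨v, hv⟩ := Function.ne_iff.mp hx
  refine add_pos_of_nonneg_of_pos (Finset.sum_nonneg fun i _ => sq_nonneg _)
    (Finset.sum_pos' (fun u _ => by positivity) ⟨v, Finset.mem_univ v, ?_⟩)
  have : x v ≠ 0 := hv
  positivity

theorem shiftPos_multiCliques (k : ℕ) (p r : Fin k → ℕ) : ShiftPos (multiCliques k p r) := by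
  refine shiftPos_of_adj_iff (β := (i : Fin k) × Fin (p i)) (fun x => ⟨x.1, x.2.1⟩)
    fun u v => ?_
  rw [multiCliques, SimpleGraph.fromRel_adj]
  exact and_congr_right fun _ => ⟨fun h => h.elim id Eq.symm, Or.inl⟩

theorem shiftPos_pawCopies (q : ℕ) : ShiftPos (pawCopies q) := by
  intro x hx
  have hne : ∀ i j, i ≠ j → ∀ a b, shiftEntry (pawCopies q) (i, a) (j, b) = 0 := by
    intro i j hij a b
    simp [shiftEntry, pawCopies, hij, hij.symm]
  have hform : shiftForm (pawCopies q) x = ∑ i, ∑ a, ∑ b, x (i, a) * x (i, b) *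
      shiftEntry (pawCopies q) (i, a) (i, b) := by
    simp only [shiftForm, Fintype.sum_prod_type]
    refine Finset.sum_congr rfl fun i _ => Finset.sum_congr rfl fun a _ => ?_
    refine Finset.sum_eq_single i (fun j _ hj => ?_) (by simp)
    exact Finset.sum_eq_zero fun b _ => by rw [hne i j hj.symm, mul_zero]
  have hpaw : ∀ i, (∑ a, ∑ b, x (i, a) * x (i, b) * shiftEntry (pawCopies q) (i, a) (i, b)) =
      3 / 2 * (x (i, 1) + 2 / 3 * x (i, 0)) ^ 2
        + 5 / 4 * (x (i, 2) + x (i, 3) + 4 / 5 * x (i, 0)) ^ 2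
        + 1 / 4 * (x (i, 2) - x (i, 3)) ^ 2 + 1 / 30 * x (i, 0) ^ 2 := by
    intro i
    simp [Fin.sum_univ_four, shiftEntry, pawCopies]
    ring
  rw [hform]
  simp only [hpaw]
  obtain ⟨⟨i, a⟩, hv⟩ := Function.ne_iff.mp hx
  refine Finset.sum_pos' (fun _ _ => by positivity) ⟨i, Finset.mem_univ i, ?_⟩
  by_contra! hle
  have e0 : x (i, 0) = 0 := by
    by_contra h
    have : 0 < x (i, 0) ^ 2 := by positivity
    nlinarith [sq_nonneg (x (i, 1) + 2 / 3 * x (i, 0)),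
      sq_nonneg (x (i, 2) + x (i, 3) + 4 / 5 * x (i, 0)), sq_nonneg (x (i, 2) - x (i, 3))]
  rw [e0] at hle
  have e1 : x (i, 1) = 0 := by
    nlinarith [sq_nonneg (x (i, 1)), sq_nonneg (x (i, 2) + x (i, 3)),
      sq_nonneg (x (i, 2) - x (i, 3))]
  have e2 : x (i, 2) + x (i, 3) = 0 := by
    nlinarith [sq_nonneg (x (i, 1)), sq_nonneg (x (i, 2) + x (i, 3)),
      sq_nonneg (x (i, 2) - x (i, 3))]
  have e3 : x (i, 2) - x (i, 3) = 0 := by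
    nlinarith [sq_nonneg (x (i, 1)), sq_nonneg (x (i, 2) + x (i, 3)),
      sq_nonneg (x (i, 2) - x (i, 3))]
  refine hv ?_
  fin_cases a
  · exact e0
  · exact e1
  · change x (i, 2) = 0
    linarith
  · change x (i, 3) = 0
    linarith

theorem shiftPos_path3Copies (s : ℕ) : ShiftPos (path3Copies s) := by
  refine (shiftPos_pawCopies s).of_embedding ⟨⟨fun x => (x.1, ![1, 0, 2] x.2), ?_⟩, ?_⟩
  · rintro ⟨i, a⟩ ⟨j, b⟩ h
    obtain ⟨hij, hab⟩ := Prod.ext_iff.mp h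
    have hinj : Function.Injective (![1, 0, 2] : Fin 3 → Fin 4) := by decide
    exact Prod.ext hij (hinj hab)
  · rintro ⟨i, a⟩ ⟨j, b⟩
    change (pawCopies s).Adj (i, ![1, 0, 2] a) (j, ![1, 0, 2] b) ↔ _
    by_cases hij : i = j
    · subst hij
      fin_cases a <;> fin_cases b <;> simp [pawCopies, path3Copies]
    · simp [pawCopies, path3Copies, hij, Ne.symm hij]

theorem negOnHyperplane_relaxedBlockStar (k : ℕ) (p r : Fin k → ℕ) (q s : ℕ) :
    NegOnHyperplane (relaxedBlockStar k p r q s) :=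
  (negOnHyperplane_graphJoin_top_iff _).mpr <| shiftPos_graphSum (shiftPos_multiCliques k p r) <|
    shiftPos_graphSum (shiftPos_pawCopies q) (shiftPos_path3Copies s)

end BlockStar

section ForbiddenSubgraphs

theorem nonempty_embedding_of_lt {k : ℕ} {W : Type*} (P : SimpleGraph (Fin k))
    (H : SimpleGraph W) (e : Fin k → W)
    (h : ∀ i j, i < j → e i ≠ e j ∧ (H.Adj (e i) (e j) ↔ P.Adj i j)) : Nonempty (P ↪g H) := by
  refine ⟨⟨⟨e, fun i j hij => ?_⟩, fun {i j} => ?_⟩⟩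
  · by_contra hne
    rcases lt_or_gt_of_ne hne with hlt | hlt
    · exact (h i j hlt).1 hij
    · exact (h j i hlt).1 hij.symm
  · change H.Adj (e i) (e j) ↔ _
    rcases lt_trichotomy i j with hlt | rfl | hlt
    · exact (h i j hlt).2
    · simp
    · rw [H.adj_comm, P.adj_comm]
      exact (h j i hlt).2

theorem ShiftPos.negOnHyperplane {V : Type*} [Fintype V] {G : SimpleGraph V} (hG : ShiftPos G) :
    NegOnHyperplane G := by
  refine ⟨fun _ => 1, fun x hx hsum => ?_⟩
  have : ∑ u, x u = 0 := by simpa [dotProduct] using hsum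
  simpa [this] using hG x hx

theorem not_negOnHyperplane_path4 : ¬ NegOnHyperplane path4 := by
  intro h
  obtain ⟨a, b, hab⟩ := h.exists_lt ![1, -2, 2, -1] 1 (by
    intro a b hab
    have h0 := congrFun hab 0
    have h3 := congrFun hab 3
    simp at h0 h3
    constructor <;> linarith)
  simp [shiftForm, shiftEntry, path4, Fin.sum_univ_four] at hab
  nlinarith [sq_nonneg a, sq_nonneg b]

theorem not_negOnHyperplane_cycle4 : ¬ NegOnHyperplane cycle4 := by
  intro h
  obtain ⟨a, b, hab⟩ := h.exists_lt ![1, -1, 1, -1] 1 (by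
    intro a b hab
    have h0 := congrFun hab 0
    have h3 := congrFun hab 3
    simp at h0 h3
    constructor <;> linarith)
  simp [shiftForm, shiftEntry, cycle4, Fin.sum_univ_four] at hab
  nlinarith [sq_nonneg a, sq_nonneg b]

theorem not_shiftPos_diamondGraph : ¬ ShiftPos diamondGraph := by
  intro h
  have := h ![1, 1, -1, -1] (fun h0 => by simpa using congrFun h0 0)
  simp [shiftForm, shiftEntry, diamondGraph, Fin.sum_univ_four] at this
  norm_num at this

/-- The star `K_1 ⊕ 3K_1` with centre `0`. -/
def clawGraph : SimpleGraph (Fin 4) :=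
  SimpleGraph.fromRel fun x _ => x = 0

/-- The butterfly `K_1 ⊕ 2K_2` with centre `0`. -/
def butterflyGraph : SimpleGraph (Fin 5) :=
  SimpleGraph.fromRel fun x y => x = 0 ∨ (x = 1 ∧ y = 2) ∨ (x = 3 ∧ y = 4)

/-- The graph `K_1 ⊕ (K_1 ∪ K_3)` with centre `0` and pendant vertex `1`. -/
def pendantK4 : SimpleGraph (Fin 5) :=
  SimpleGraph.fromRel fun x y => x = 0 ∨ (x ≠ 1 ∧ y ≠ 1)

theorem not_shiftPos_clawGraph : ¬ ShiftPos clawGraph := by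
  intro h
  have := h ![5, -3, -3, -3] (fun h0 => by simpa using congrFun h0 0)
  simp [shiftForm, shiftEntry, clawGraph, Fin.sum_univ_four] at this
  norm_num at this

theorem not_shiftPos_butterflyGraph : ¬ ShiftPos butterflyGraph := by
  intro h
  have := h ![-5, 2, 2, 2, 2] (fun h0 => by simpa using congrFun h0 0)
  simp [shiftForm, shiftEntry, butterflyGraph, Fin.sum_univ_five] at this
  norm_num at this

theorem not_shiftPos_pendantK4 : ¬ ShiftPos pendantK4 := by
  intro h
  have := h ![21, -14, -6, -6, -6] (fun h0 => by simpa using congrFun h0 0)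
  simp [shiftForm, shiftEntry, pendantK4, Fin.sum_univ_five] at this
  norm_num at this

end ForbiddenSubgraphs

/-- In a graph with no induced `P_4` or `C_4` every component has a universal vertex. -/
theorem exists_universal_of_reachable {V : Type*} [Fintype V] {G : SimpleGraph V}
    (hG : NegOnHyperplane G) (u : V) :
    ∃ c, G.Reachable u c ∧ ∀ w, G.Reachable u w → w ≠ c → G.Adj c w := by
  classical
  obtain ⟨c, hc, hmax⟩ := Finset.exists_max_image (Finset.univ.filter fun w => G.Reachable u w)
    (fun w => G.degree w) ⟨u, by simp⟩
  simp only [Finset.mem_filter, Finset.mem_univ, true_and] at hc hmax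
  have hclosed : ∀ w x, G.Adj c w → G.Adj w x → x ≠ c → G.Adj c x := by
    intro w x hcw hwx hxc
    by_contra hcx
    obtain ⟨z, hcz, hzw, hwz⟩ : ∃ z, G.Adj c z ∧ z ≠ w ∧ ¬ G.Adj w z := by
      by_contra! hall
      have hsub : insert x (insert c ((G.neighborFinset c).erase w)) ⊆ G.neighborFinset w := by
        intro z hz
        simp only [Finset.mem_insert, Finset.mem_erase, SimpleGraph.mem_neighborFinset] at hz ⊢
        rcases hz with rfl | rfl | ⟨hzw, hcz⟩
        · exact hwx
        · exact hcw.symm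
        · exact hall z hcz hzw
      have hcard := Finset.card_le_card hsub
      have hmem : w ∈ G.neighborFinset c := by simpa using hcw
      rw [Finset.card_insert_of_notMem (by simp [hxc, hcx]),
        Finset.card_insert_of_notMem (by simp), Finset.card_erase_add_one hmem] at hcard
      have := hmax w (hc.trans hcw.reachable)
      simp only [SimpleGraph.card_neighborFinset_eq_degree] at hcard
      omega
    have hzx : z ≠ x := fun h => hcx (h ▸ hcz)
    have hzc := hcz.symm
    have hzw' : ¬ G.Adj z w := fun h => hwz h.symm
    by_cases hadj : G.Adj z x
    · obtain ⟨f⟩ := nonempty_embedding_of_lt cycle4 G ![z, c, w, x] (by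
        simp [Fin.forall_fin_succ, cycle4, *, hzc.ne, hcw.ne, hwx.ne, hxc.symm])
      exact not_negOnHyperplane_cycle4 (hG.of_embedding f)
    · obtain ⟨f⟩ := nonempty_embedding_of_lt path4 G ![z, c, w, x] (by
        simp [Fin.forall_fin_succ, path4, *, hzc.ne, hcw.ne, hwx.ne, hxc.symm])
      exact not_negOnHyperplane_path4 (hG.of_embedding f)
  refine ⟨c, hc, fun w hw hwc => ?_⟩
  have hreach : ∀ w, G.Reachable c w → w = c ∨ G.Adj c w := by
    intro w hw
    rw [SimpleGraph.reachable_iff_reflTransGen] at hw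
    induction hw with
    | refl => exact Or.inl rfl
    | tail _ hbx ih =>
      rename_i x y _
      by_cases hyc : y = c
      · exact Or.inl hyc
      rcases ih with rfl | hcx
      · exact Or.inr hbx
      · exact Or.inr (hclosed x y hcx hbx hyc)
  exact (hreach w (hc.symm.trans hw)).resolve_left hwc

section Blocks

variable {W : Type*} [Fintype W] {H : SimpleGraph W}

theorem ShiftPos.adj_trans (hH : ShiftPos H) {c x y z : W} (hx : H.Adj c x) (hy : H.Adj c y)
    (hz : H.Adj c z) (hxy : H.Adj x y) (hyz : H.Adj y z) (hxz : x ≠ z) : H.Adj x z := by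
  by_contra h
  obtain ⟨f⟩ := nonempty_embedding_of_lt diamondGraph H ![c, y, x, z] (by
    simp [Fin.forall_fin_succ, diamondGraph, *, hx.ne, hy.ne, hz.ne, hxy.ne', hyz.ne, hxy.symm])
  exact not_shiftPos_diamondGraph (hH.of_embedding f)

theorem ShiftPos.adj_or_adj (hH : ShiftPos H) {c a b x : W} (ha : H.Adj c a) (hb : H.Adj c b)
    (hx : H.Adj c x) (hab : a ≠ b) (hnab : ¬ H.Adj a b) (hxa : x ≠ a) (hxb : x ≠ b) :
    H.Adj a x ∨ H.Adj b x := by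
  by_contra! h
  obtain ⟨f⟩ := nonempty_embedding_of_lt clawGraph H ![c, a, b, x] (by
    simp [Fin.forall_fin_succ, clawGraph, *, ha.ne, hb.ne, hx.ne, hxa.symm, hxb.symm])
  exact not_shiftPos_clawGraph (hH.of_embedding f)

/-- Two non-adjacent neighbours `a`, `b` of `c` cannot both have common neighbours with `c`. -/
theorem ShiftPos.isolated_or_isolated (hH : ShiftPos H) {c a b : W} (ha : H.Adj c a)
    (hb : H.Adj c b) (hab : a ≠ b) (hnab : ¬ H.Adj a b) :
    (∀ x, H.Adj c x → ¬ H.Adj a x) ∨ ∀ x, H.Adj c x → ¬ H.Adj b x := by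
  by_contra! h
  obtain ⟨⟨x, hx, hax⟩, y, hy, hby⟩ := h
  have hxb : x ≠ b := fun h => hnab (h ▸ hax)
  have hya : y ≠ a := fun h => hnab (h ▸ hby.symm)
  have hnxb : ¬ H.Adj x b := fun h => hnab (hH.adj_trans ha hx hb hax h hab)
  have hnay : ¬ H.Adj a y := fun h => hnab (hH.adj_trans ha hy hb h hby.symm hab)
  have hxy : x ≠ y := fun h => hnay (h ▸ hax)
  have hnxy : ¬ H.Adj x y := fun h => hnay (hH.adj_trans ha hx hy hax h hya.symm)
  obtain ⟨f⟩ := nonempty_embedding_of_lt butterflyGraph H ![c, a, x, b, y] (by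
    simp [Fin.forall_fin_succ, butterflyGraph, *, ha.ne, hb.ne, hx.ne, hy.ne, hax.ne, hby.ne,
      hya.symm])
  exact not_shiftPos_butterflyGraph (hH.of_embedding f)

/-- `pos` labels the closed neighbourhood of `c` as an induced subgraph of the paw. -/
def IsPawLabelling (H : SimpleGraph W) (c : W) (pos : W → Fin 4) : Prop :=
  ∀ x y, (x = c ∨ H.Adj c x) → (y = c ∨ H.Adj c y) → (pos x = pos y → x = y) ∧
    (H.Adj x y ↔ x ≠ y ∧ (pos x = 0 ∨ pos y = 0 ∨
      (pos x = 2 ∧ pos y = 3) ∨ (pos x = 3 ∧ pos y = 2)))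

theorem ShiftPos.exists_isPawLabelling (hH : ShiftPos H) {c a b : W} (ha : H.Adj c a)
    (hb : H.Adj c b) (hab : a ≠ b) (hnab : ¬ H.Adj a b)
    (hiso : ∀ x, H.Adj c x → ¬ H.Adj b x) : ∃ pos, IsPawLabelling H c pos := by
  classical
  have hthird : ∀ x, H.Adj c x → x ≠ a → x ≠ b → H.Adj a x := fun x hx hxa hxb =>
    (hH.adj_or_adj ha hb hx hab hnab hxa hxb).resolve_right (hiso x hx)
  have huniq : ∀ x y, H.Adj c x → x ≠ a → x ≠ b → H.Adj c y → y ≠ a → y ≠ b → x = y := by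
    intro x y hx hxa hxb hy hya hyb
    by_contra hxy
    have hax := hthird x hx hxa hxb
    have hay := hthird y hy hya hyb
    have hadj := hH.adj_trans hx ha hy hax.symm hay hxy
    have hbx := hiso x hx
    have hby := hiso y hy
    have hba := hiso a ha
    obtain ⟨f⟩ := nonempty_embedding_of_lt pendantK4 H ![c, b, a, x, y] (by
      simp [Fin.forall_fin_succ, pendantK4, *, ha.ne, hb.ne, hx.ne, hy.ne, hax.ne, hay.ne,
        hab.symm, hxb.symm, hyb.symm])
    exact not_shiftPos_pendantK4 (hH.of_embedding f)
  have hca := ha.ne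
  have hcb := hb.ne
  set pos : W → Fin 4 := fun x => if x = c then 0 else if x = b then 1 else if x = a then 2 else 3
    with hpos
  have hcases : ∀ x, (x = c ∨ H.Adj c x) → (x = c ∧ pos x = 0) ∨ (x = b ∧ pos x = 1) ∨
      (x = a ∧ pos x = 2) ∨ (H.Adj c x ∧ x ≠ a ∧ x ≠ b ∧ pos x = 3) := by
    intro x hx
    by_cases hxc : x = c
    · exact Or.inl ⟨hxc, by simp [hpos, hxc]⟩
    have hcx := hx.resolve_left hxc
    by_cases hxb : x = b
    · exact Or.inr (Or.inl ⟨hxb, by simp [hpos, hxb, hcb.symm]⟩)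
    by_cases hxa : x = a
    · exact Or.inr (Or.inr (Or.inl ⟨hxa, by simp [hpos, hxa, hca.symm, hab]⟩))
    · exact Or.inr (Or.inr (Or.inr ⟨hcx, hxa, hxb, by simp [hpos, hxc, hxa, hxb]⟩))
  have hnba : ¬ H.Adj b a := hiso a ha
  refine ⟨pos, fun x y hx hy => ?_⟩
  rcases hcases x hx with ⟨ex, px⟩ | ⟨ex, px⟩ | ⟨ex, px⟩ | ⟨hcx, hxa, hxb, px⟩ <;>
  rcases hcases y hy with ⟨ey, py⟩ | ⟨ey, py⟩ | ⟨ey, py⟩ | ⟨hcy, hya, hyb, py⟩ <;>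
  rw [px, py]
  all_goals grind [SimpleGraph.adj_comm, SimpleGraph.irrefl]


/-- Each closed neighbourhood is a clique, a path `P_3` or a paw. -/
theorem ShiftPos.isClique_or_exists_isPawLabelling (hH : ShiftPos H) (c : W) :
    (∀ x y, H.Adj c x → H.Adj c y → x ≠ y → H.Adj x y) ∨ ∃ pos, IsPawLabelling H c pos := by
  by_contra! h
  obtain ⟨⟨a, b, ha, hb, hab, hnab⟩, hpos⟩ := h
  rcases hH.isolated_or_isolated ha hb hab hnab with hiso | hiso
  · obtain ⟨pos, h⟩ := hH.exists_isPawLabelling hb ha hab.symm (fun h => hnab h.symm) hiso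
    exact hpos pos h
  · obtain ⟨pos, h⟩ := hH.exists_isPawLabelling ha hb hab hnab hiso
    exact hpos pos h

theorem ShiftPos.exists_centre (hH : ShiftPos H) :
    ∃ c : W → W, (∀ u, u = c u ∨ H.Adj (c u) u) ∧ ∀ u w, H.Adj u w → c u = c w := by
  choose cen hreach huniv using
    fun u : W => exists_universal_of_reachable hH.negOnHyperplane u
  refine ⟨fun u => cen (H.connectedComponentMk u).out, fun u => ?_, fun u w huw => ?_⟩
  · have hu : H.Reachable (H.connectedComponentMk u).out u :=
      SimpleGraph.ConnectedComponent.exact (Quot.out_eq _)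
    exact or_iff_not_imp_left.mpr (huniv _ u hu)
  · simp only [SimpleGraph.ConnectedComponent.sound huw.reachable]

theorem pawCopies_adj_same {q : ℕ} (i : Fin q) (a b : Fin 4) :
    (pawCopies q).Adj (i, a) (i, b) ↔
      a ≠ b ∧ (a = 0 ∨ b = 0 ∨ (a = 2 ∧ b = 3) ∨ (a = 3 ∧ b = 2)) := by
  fin_cases a <;> fin_cases b <;> simp [pawCopies]

theorem ShiftPos.nonempty_embedding (hH : ShiftPos H) {n : ℕ} (idx : W ↪ Fin n) :
    Nonempty (H ↪g graphSum (multiCliques 1 (fun _ => n) fun _ => n)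
      (graphSum (pawCopies n) (path3Copies 1))) := by
  classical
  obtain ⟨c, hc, hadj⟩ := hH.exists_centre
  choose pos hpos using fun d (h : ¬ ∀ x y, H.Adj d x → H.Adj d y → x ≠ y → H.Adj x y) =>
    (hH.isClique_or_exists_isPawLabelling d).resolve_left h
  set f : W → ((_ : Fin 1) × (Fin n × Fin n)) ⊕ ((Fin n × Fin 4) ⊕ (Fin 1 × Fin 3)) := fun u =>
    if h : ∀ x y, H.Adj (c u) x → H.Adj (c u) y → x ≠ y → H.Adj x y then
      inl ⟨0, idx (c u), idx u⟩
    else inr (inl (idx (c u), pos (c u) h u)) with hf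
  have hcase : ∀ u,
      ((∀ x y, H.Adj (c u) x → H.Adj (c u) y → x ≠ y → H.Adj x y) ∧
        f u = inl ⟨0, idx (c u), idx u⟩) ∨
      ∃ h, f u = inr (inl (idx (c u), pos (c u) h u)) := by
    intro u
    by_cases h : ∀ x y, H.Adj (c u) x → H.Adj (c u) y → x ≠ y → H.Adj x y
    · exact Or.inl ⟨h, dif_pos h⟩
    · exact Or.inr ⟨h, dif_neg h⟩
  have hblock : ∀ {u w} h, c u = c w → (pos (c u) h u = pos (c u) h w → u = w) ∧
      (H.Adj u w ↔ u ≠ w ∧ (pos (c u) h u = 0 ∨ pos (c u) h w = 0 ∨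
        (pos (c u) h u = 2 ∧ pos (c u) h w = 3) ∨ (pos (c u) h u = 3 ∧ pos (c u) h w = 2))) :=
    fun {u w} h huw => hpos (c u) h u w (hc u) (huw ▸ hc w)
  have hcongr : ∀ {d e} (hde : d = e) h h' w, pos d h w = pos e h' w := by
    rintro d e rfl h h' w; rfl
  refine ⟨⟨⟨f, fun u w huw => ?_⟩, fun {u w} => ?_⟩⟩
  · rcases hcase u with ⟨hu, eu⟩ | ⟨hu, eu⟩ <;> rcases hcase w with ⟨hw, ew⟩ | ⟨hw, ew⟩ <;>
      rw [eu, ew] at huw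
    · exact idx.injective (congrArg (fun s : (_ : Fin 1) × (Fin n × Fin n) => s.2.2)
        (inl_injective huw))
    · simp at huw
    · simp at huw
    · simp only [inr.injEq, inl.injEq, Prod.mk.injEq, idx.injective.eq_iff] at huw
      obtain ⟨hcc, hp⟩ := huw
      exact (hblock hu hcc).1 (hp.trans (hcongr hcc.symm hw hu w))
  · change (graphSum _ _).Adj (f u) (f w) ↔ _
    rcases hcase u with ⟨hu, eu⟩ | ⟨hu, eu⟩ <;> rcases hcase w with ⟨hw, ew⟩ | ⟨hw, ew⟩ <;>
      rw [eu, ew]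
    · rw [graphSum_adj_inl]
      by_cases hcc : c u = c w
      · have : H.Adj u w ↔ u ≠ w := by
          refine ⟨fun h => h.ne, fun h => ?_⟩
          rcases hc u with h1 | h1 <;> rcases hc w with h2 | h2
          · exact absurd (h1.trans (hcc.trans h2.symm)) h
          · rwa [h1, hcc]
          · rw [h2, ← hcc]; exact h1.symm
          · exact hu u w h1 (hcc ▸ h2) h
        rw [this]
        simp [multiCliques, hcc]
      · have : ¬ H.Adj u w := fun h => hcc (hadj u w h)
        simp [multiCliques, this, hcc, Ne.symm hcc]
    · have : ¬ H.Adj u w := fun h => hw (hadj u w h ▸ hu)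
      simp [graphSum, this]
    · have : ¬ H.Adj u w := fun h => hu (hadj u w h ▸ hw)
      simp [graphSum, this]
    · rw [graphSum_adj_inr, graphSum_adj_inl]
      by_cases hcc : c u = c w
      · obtain ⟨hinj, hiff⟩ := hblock hu hcc
        rw [hiff, hcongr hcc.symm hw hu w, show idx (c w) = idx (c u) by rw [hcc]]
        have : pos (c u) hu u = pos (c u) hu w ↔ u = w := ⟨hinj, fun h => congrArg (pos (c u) hu) h⟩
        rw [pawCopies_adj_same, ne_eq, ne_eq, this]
      · have : ¬ H.Adj u w := fun h => hcc (hadj u w h)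
        simp [pawCopies, this, hcc, Ne.symm hcc]

end Blocks

section Cone

variable {V : Type*} {G : SimpleGraph V} {v : V}

/-- A graph with a universal vertex contains the cone over the remaining vertices. -/
def coneEmbedding (hv : ∀ w, w ≠ v → G.Adj v w) :
    graphJoin (⊤ : SimpleGraph Unit) (G.induce {w | w ≠ v}) ↪g G where
  toFun := Sum.elim (fun _ => v) Subtype.val
  inj' := by
    rintro (_ | ⟨x, hx⟩) (_ | ⟨y, hy⟩) h
    · rfl
    · exact absurd h.symm hy
    · exact absurd h hx
    · exact congrArg inr (Subtype.ext h)
  map_rel_iff' := by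
    rintro (_ | ⟨x, hx⟩) (_ | ⟨y, hy⟩)
    · simp
    · simpa [graphJoin] using hv y hy
    · simpa [graphJoin] using (hv x hx).symm
    · rw [graphJoin_adj_inr]
      rfl

theorem nonempty_embedding_cone {W : Type*} {H : SimpleGraph W} (hv : ∀ w, w ≠ v → G.Adj v w)
    (g : G.induce {w | w ≠ v} ↪g H) :
    Nonempty (G ↪g graphJoin (⊤ : SimpleGraph Unit) H) := by
  classical
  set f : V → Unit ⊕ W := fun u => if h : u = v then inl () else inr (g ⟨u, h⟩) with hf
  have hfv : f v = inl () := dif_pos rfl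
  have hfu : ∀ u (h : u ≠ v), f u = inr (g ⟨u, h⟩) := fun u h => dif_neg h
  refine ⟨⟨⟨f, fun x y hxy => ?_⟩, fun {x y} => ?_⟩⟩
  · by_cases hx : x = v <;> by_cases hy : y = v
    · rw [hx, hy]
    · rw [hx, hfv, hfu y hy] at hxy
      simp at hxy
    · rw [hy, hfv, hfu x hx] at hxy
      simp at hxy
    · rw [hfu x hx, hfu y hy] at hxy
      exact congrArg Subtype.val (g.injective (inr_injective hxy))
  · change (graphJoin _ _).Adj (f x) (f y) ↔ _
    by_cases hx : x = v <;> by_cases hy : y = v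
    · simp [hx, hy]
    · rw [hx, hfv, hfu y hy]
      simpa [graphJoin] using hv y hy
    · rw [hy, hfv, hfu x hx]
      simpa [graphJoin] using (hv x hx).symm
    · rw [hfu x hx, hfu y hy, graphJoin_adj_inr, g.map_adj_iff]
      rfl

end Cone

/-- A finite connected graph of diameter 2 satisfies `λ₂ < -1/2` if and only if it
is isomorphic to a connected induced subgraph of a relaxed block star. -/
theorem stmt_18 {V : Type*} [Fintype V] [DecidableEq V] (G : SimpleGraph V)
    (hconn : G.Connected) (hdiam : graphDiam G = 2) :
    lambda2 G < -1/2 ↔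
      ∃ (k : ℕ) (p r : Fin k → ℕ) (q s : ℕ), 0 < k ∧ (∀ i, 0 < p i) ∧ (∀ i, 0 < r i) ∧
        0 < q ∧ 0 < s ∧ IsoToConnectedInducedSubgraph G (relaxedBlockStar k p r q s) := by
  rw [lambda2_lt_iff_negOnHyperplane G hconn hdiam]
  constructor
  · intro hG
    classical
    obtain ⟨u⟩ := hconn.nonempty
    obtain ⟨v, -, huniv⟩ := exists_universal_of_reachable hG u
    have hv : ∀ w, w ≠ v → G.Adj v w := fun w => huniv w (hconn u w)
    have hpos : ShiftPos (G.induce {w | w ≠ v}) :=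
      (negOnHyperplane_graphJoin_top_iff _).mp (hG.of_embedding (coneEmbedding hv))
    obtain ⟨g⟩ := hpos.nonempty_embedding
      ((Function.Embedding.subtype _).trans (Fintype.equivFin V).toEmbedding)
    obtain ⟨f⟩ := nonempty_embedding_cone hv g
    have hcard : 0 < Fintype.card V := Fintype.card_pos_iff.mpr ⟨v⟩
    exact ⟨1, _, _, _, 1, one_pos, fun _ => hcard, fun _ => hcard, hcard, one_pos, Set.range f,
      f.isoInduceRange.connected_iff.mp hconn, ⟨f.isoInduceRange⟩⟩
  · rintro ⟨k, p, r, q, s, -, -, -, -, -, t, -, ⟨e⟩⟩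
    exact (negOnHyperplane_relaxedBlockStar k p r q s).of_embedding
      ((SimpleGraph.Embedding.induce t).comp e.toEmbedding)
end

section
/- Let G be a finite connected simple graph of diameter 3 that is not a block graph (i.e., G is not both chordal and diamond-free). Then the second largest distance eigenvalue of G satisfies λ2(G) < −1/2 if and only if G is isomorphic to a connected induced subgraph of the graph Pt_1 or of a triple block graph Pt_2(p,q) for some integers p, q ≥ 2. -/
open Polynomial SimpleGraph Sum

open Matrix

/-- A quadratic form is Lorentzian if it is negative definite on some hyperplane
(or on the whole space). -/
def NegDefOnHyperplane {ι : Type*} [Fintype ι] (M : Matrix ι ι ℝ) : Prop :=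
  ∃ φ : ι → ℝ, ∀ z : ι → ℝ, z ≠ 0 → φ ⬝ᵥ z = 0 → z ⬝ᵥ M *ᵥ z < 0

section Spectral

variable {ι : Type*} [Fintype ι] [DecidableEq ι] {A : Matrix ι ι ℝ}

theorem sum_sq_eigenvectorBasis (hA : A.IsHermitian) (z : ι → ℝ) :
    z ⬝ᵥ z = ∑ i, ((hA.eigenvectorBasis i).ofLp ⬝ᵥ z) ^ 2 := by
  have h := hA.eigenvectorBasis.sum_inner_mul_inner (WithLp.toLp 2 z) (WithLp.toLp 2 z)
  simp only [EuclideanSpace.inner_eq_star_dotProduct] at h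
  simp only [star_trivial] at h
  rw [← h]
  refine Finset.sum_congr rfl fun i _ => ?_
  rw [sq, dotProduct_comm z]

theorem dotProduct_mulVec_eigenvectorBasis (hA : A.IsHermitian) (z : ι → ℝ) :
    z ⬝ᵥ A *ᵥ z = ∑ i, hA.eigenvalues i * ((hA.eigenvectorBasis i).ofLp ⬝ᵥ z) ^ 2 := by
  have h := hA.eigenvectorBasis.sum_inner_mul_inner (WithLp.toLp 2 z) (WithLp.toLp 2 (A *ᵥ z))
  simp only [EuclideanSpace.inner_eq_star_dotProduct] at h
  simp only [star_trivial] at h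
  rw [dotProduct_comm, ← h]
  refine Finset.sum_congr rfl fun i _ => ?_
  have hs : Aᵀ = A := by rw [← conjTranspose_eq_transpose_of_trivial]; exact hA
  have h1 : (A *ᵥ z) ⬝ᵥ (hA.eigenvectorBasis i).ofLp
      = hA.eigenvalues i * ((hA.eigenvectorBasis i).ofLp ⬝ᵥ z) := by
    have := hA.mulVec_eigenvectorBasis i
    rw [dotProduct_comm, dotProduct_mulVec, ← mulVec_transpose, hs, this, smul_dotProduct,
      smul_eq_mul]
  rw [h1]
  ring

theorem eigenvectorBasis_dotProduct (hA : A.IsHermitian) (i j : ι) :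
    (hA.eigenvectorBasis i).ofLp ⬝ᵥ (hA.eigenvectorBasis j).ofLp = if i = j then 1 else 0 := by
  have h := orthonormal_iff_ite.mp hA.eigenvectorBasis.orthonormal i j
  rw [EuclideanSpace.inner_eq_star_dotProduct] at h
  simpa [dotProduct_comm] using h

theorem shifted_form_eigenvectorBasis (hA : A.IsHermitian) (z : ι → ℝ) :
    z ⬝ᵥ ((2 : ℝ) • A + 1) *ᵥ z =
      ∑ i, (2 * hA.eigenvalues i + 1) * ((hA.eigenvectorBasis i).ofLp ⬝ᵥ z) ^ 2 := by
  rw [add_mulVec, dotProduct_add, one_mulVec, smul_mulVec, dotProduct_smul,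
    dotProduct_mulVec_eigenvectorBasis hA, sum_sq_eigenvectorBasis hA, smul_eq_mul,
    Finset.mul_sum, ← Finset.sum_add_distrib]
  exact Finset.sum_congr rfl fun i _ => by ring

theorem eigenvalues₀_one_lt_iff (hA : A.IsHermitian) (hcard : 1 < Fintype.card ι) :
    hA.eigenvalues₀ ⟨1, hcard⟩ < -1 / 2 ↔ NegDefOnHyperplane ((2 : ℝ) • A + 1) := by
  let e : Fin (Fintype.card ι) ≃ ι := Fintype.equivOfCardEq (Fintype.card_fin _)
  have he : ∀ k, hA.eigenvalues (e k) = hA.eigenvalues₀ k := fun k => by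
    simp [IsHermitian.eigenvalues, e]
  let k₀ : Fin (Fintype.card ι) := ⟨0, by omega⟩
  let k₁ : Fin (Fintype.card ι) := ⟨1, hcard⟩
  constructor
  · intro h
    refine ⟨(hA.eigenvectorBasis (e k₀)).ofLp, fun z hz hφ => ?_⟩
    rw [shifted_form_eigenvectorBasis hA]
    have hle : ∀ i, (2 * hA.eigenvalues i + 1) * ((hA.eigenvectorBasis i).ofLp ⬝ᵥ z) ^ 2 ≤
        (2 * hA.eigenvalues₀ k₁ + 1) * ((hA.eigenvectorBasis i).ofLp ⬝ᵥ z) ^ 2 := by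
      intro i
      obtain ⟨k, rfl⟩ := e.surjective i
      by_cases hk : k = k₀
      · subst hk
        rw [hφ]
        simp
      · have hk1 : k₁ ≤ k := by
          rw [Fin.le_def]
          have : (k : ℕ) ≠ 0 := fun h0 => hk (Fin.ext h0)
          change 1 ≤ (k : ℕ)
          omega
        have := hA.eigenvalues₀_antitone hk1
        rw [he]
        exact mul_le_mul_of_nonneg_right (by linarith) (sq_nonneg _)
    refine lt_of_le_of_lt (Finset.sum_le_sum fun i _ => hle i) ?_
    rw [← Finset.mul_sum, ← sum_sq_eigenvectorBasis hA]
    have hpos : 0 < z ⬝ᵥ z := by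
      have := dotProduct_self_star_pos_iff.mpr hz
      simpa using this
    have h2 : 2 * hA.eigenvalues₀ k₁ + 1 < 0 := by
      have : hA.eigenvalues₀ k₁ < -1 / 2 := h
      linarith
    exact mul_neg_of_neg_of_pos h2 hpos
  · rintro ⟨φ, hφ⟩
    by_contra hcon
    have h1 : -1 / 2 ≤ hA.eigenvalues₀ k₁ := not_lt.mp hcon
    have h0 : -1 / 2 ≤ hA.eigenvalues₀ k₀ :=
      h1.trans (hA.eigenvalues₀_antitone (by rw [Fin.le_def]; exact Nat.zero_le _))
    have hne : e k₀ ≠ e k₁ := by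
      intro h
      have := e.injective h
      simp [k₀, k₁] at this
    set b₀ := (hA.eigenvectorBasis (e k₀)).ofLp with hb₀
    set b₁ := (hA.eigenvectorBasis (e k₁)).ofLp with hb₁
    obtain ⟨s, t, hst, hort⟩ : ∃ s t : ℝ, (s ≠ 0 ∨ t ≠ 0) ∧ φ ⬝ᵥ (s • b₀ + t • b₁) = 0 := by
      by_cases h : φ ⬝ᵥ b₀ = 0
      · exact ⟨1, 0, Or.inl one_ne_zero, by simp [h]⟩
      · refine ⟨-(φ ⬝ᵥ b₁), φ ⬝ᵥ b₀, Or.inr h, ?_⟩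
        rw [dotProduct_add, dotProduct_smul, dotProduct_smul, smul_eq_mul, smul_eq_mul]
        ring
    have hcoord : ∀ i, (hA.eigenvectorBasis i).ofLp ⬝ᵥ (s • b₀ + t • b₁) =
        s * (if i = e k₀ then 1 else 0) + t * (if i = e k₁ then 1 else 0) := by
      intro i
      rw [dotProduct_add, dotProduct_smul, dotProduct_smul, eigenvectorBasis_dotProduct,
        eigenvectorBasis_dotProduct, smul_eq_mul, smul_eq_mul]
    have hz : s • b₀ + t • b₁ ≠ 0 := by
      intro hz
      have hs := hcoord (e k₀)
      have ht := hcoord (e k₁)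
      rw [hz] at hs ht
      simp [hne, hne.symm] at hs ht
      rcases hst with h | h
      · exact h hs.symm
      · exact h ht.symm
    have hneg := hφ _ hz hort
    rw [shifted_form_eigenvectorBasis hA] at hneg
    refine absurd hneg (not_lt.mpr (Finset.sum_nonneg fun i _ => ?_))
    rw [hcoord]
    by_cases hi0 : i = e k₀
    · rw [hi0, he]
      exact mul_nonneg (by linarith) (sq_nonneg _)
    · by_cases hi1 : i = e k₁
      · rw [hi1, he]
        exact mul_nonneg (by linarith) (sq_nonneg _)
      · simp [hi0, hi1]

end Spectral

section DistanceForm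

variable {V : Type*} [Fintype V] (G : SimpleGraph V)

theorem distMatrix_isHermitian : (distMatrix G).IsHermitian := by
  ext u v
  simp [distMatrix, conjTranspose, SimpleGraph.dist_comm]

theorem lambda2_eq_eigenvalues₀ [DecidableEq V] (hcard : 1 < Fintype.card V) :
    lambda2 G = (distMatrix_isHermitian G).eigenvalues₀ ⟨1, hcard⟩ := by
  set hA := distMatrix_isHermitian G
  have hsort : (distMatrix G).charpoly.roots.sort (· ≤ ·) = (List.ofFn hA.eigenvalues₀).reverse := by
    refine List.Perm.eq_of_sortedLE (Multiset.pairwise_sort _ _).sortedLE ?_ ?_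
    · rw [List.sortedLE_reverse]
      exact hA.eigenvalues₀_antitone.sortedGE_ofFn
    · refine List.Perm.trans ?_ (List.reverse_perm _).symm
      rw [← Multiset.coe_eq_coe, Multiset.sort_eq, hA.roots_charpoly_eq_eigenvalues₀,
        Fin.univ_val_map]
      rfl
  rw [lambda2, hsort, List.getD_eq_getElem _ _ (by simp; omega)]
  rw [List.getElem_reverse, List.getElem_ofFn]
  congr 1
  ext
  simp
  omega

/-- The matrix `2 D + I`, where `D` is the distance matrix. -/
noncomputable def shiftedDist [DecidableEq V] : Matrix V V ℝ := (2 : ℝ) • distMatrix G + 1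

theorem shiftedDist_apply [DecidableEq V] (u v : V) :
    shiftedDist G u v = 2 * (G.dist u v : ℝ) + if u = v then 1 else 0 := by
  simp [shiftedDist, distMatrix, Matrix.one_apply]

theorem lambda2_lt_iff [DecidableEq V] (hcard : 1 < Fintype.card V) :
    lambda2 G < -1 / 2 ↔ NegDefOnHyperplane (shiftedDist G) := by
  rw [lambda2_eq_eigenvalues₀ G hcard, eigenvalues₀_one_lt_iff]
  rfl

end DistanceForm

section Lorentzian

variable {ι : Type*} [Fintype ι]

/-- Reversed Cauchy-Schwarz: a Lorentzian form is negative on the orthogonal complement of a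
vector on which it is positive. -/
theorem NegDefOnHyperplane.neg_of_orthogonal {M : Matrix ι ι ℝ} (h : NegDefOnHyperplane M)
    (hM : M.IsSymm) {p z : ι → ℝ} (hp : 0 < p ⬝ᵥ M *ᵥ p) (hz : z ≠ 0)
    (hpz : p ⬝ᵥ M *ᵥ z = 0) : z ⬝ᵥ M *ᵥ z < 0 := by
  obtain ⟨φ, hφ⟩ := h
  have hzp : z ⬝ᵥ M *ᵥ p = 0 := by
    rw [dotProduct_mulVec, ← mulVec_transpose, hM, dotProduct_comm, hpz]
  have hp0 : p ≠ 0 := by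
    rintro rfl
    simp at hp
  have hφp : φ ⬝ᵥ p ≠ 0 := fun h0 => (hφ p hp0 h0).not_gt hp
  set s := φ ⬝ᵥ p with hs
  set t := φ ⬝ᵥ z with ht
  have hw : s • z - t • p ≠ 0 := by
    intro h0
    have h1 : s • z = t • p := sub_eq_zero.mp h0
    have h2 : t * (p ⬝ᵥ M *ᵥ p) = 0 := by
      rw [← smul_eq_mul, ← dotProduct_smul, ← mulVec_smul, ← h1, mulVec_smul, dotProduct_smul, hpz,
        smul_zero]
    rcases mul_eq_zero.mp h2 with h3 | h3
    · rw [h3, zero_smul] at h1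
      rcases smul_eq_zero.mp h1 with h4 | h4
      · exact hφp h4
      · exact hz h4
    · exact hp.ne' h3
  have hneg := hφ _ hw (by
    rw [dotProduct_sub, dotProduct_smul, dotProduct_smul, smul_eq_mul, smul_eq_mul, ← hs, ← ht]
    ring)
  have hexp : (s • z - t • p) ⬝ᵥ M *ᵥ (s • z - t • p) =
      s ^ 2 * (z ⬝ᵥ M *ᵥ z) + t ^ 2 * (p ⬝ᵥ M *ᵥ p) := by
    simp only [mulVec_sub, mulVec_smul, dotProduct_sub, sub_dotProduct, smul_dotProduct,
      dotProduct_smul, smul_eq_mul, hpz, hzp]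
    ring
  rw [hexp] at hneg
  have h2 : s ^ 2 * (z ⬝ᵥ M *ᵥ z) < 0 := by nlinarith [sq_nonneg t]
  by_contra hcon
  exact absurd h2 (not_lt.mpr (mul_nonneg (sq_nonneg s) (not_lt.mp hcon)))

theorem shiftedDist_isSymm [DecidableEq ι] (G : SimpleGraph ι) : (shiftedDist G).IsSymm := by
  ext u v
  simp [Matrix.transpose_apply, shiftedDist_apply, SimpleGraph.dist_comm, eq_comm]

end Lorentzian

/-- Four integers, used for the distances of a vertex to the four vertices of a path. -/
abbrev Quad := ℕ × ℕ × ℕ × ℕ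

/-- The form `-60 M⁻¹`, with sign changed, of the matrix `M = 2 D + I` of a path on four
vertices: fifteen times the inverse of `M`, evaluated at the doubled arguments. -/
def pathForm (s t : Quad) : ℤ :=
  4 * ((s.1 : ℤ) * (-9 * t.1 + 18 * t.2.1 - 12 * t.2.2.1 + 6 * t.2.2.2)
    + (s.2.1 : ℤ) * (18 * t.1 - 41 * t.2.1 + 34 * t.2.2.1 - 12 * t.2.2.2)
    + (s.2.2.1 : ℤ) * (-12 * t.1 + 34 * t.2.1 - 41 * t.2.2.1 + 18 * t.2.2.2)
    + (s.2.2.2 : ℤ) * (6 * t.1 - 12 * t.2.1 + 18 * t.2.2.1 - 9 * t.2.2.2))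

section Path

variable {V : Type*} (G : SimpleGraph V)

/-- The distances of `v` to the vertices `x, a, b, y`. -/
noncomputable def quad (x a b y v : V) : Quad := (G.dist x v, G.dist a v, G.dist b v, G.dist y v)

/-- `x, a, b, y` is a shortest path of length three. -/
structure IsGeodesic (x a b y : V) : Prop where
  xa : G.dist x a = 1
  ab : G.dist a b = 1
  yb : G.dist y b = 1
  xb : G.dist x b = 2
  ya : G.dist y a = 2
  xy : G.dist x y = 3

variable {G}

theorem IsGeodesic.symm {x a b y : V} (h : IsGeodesic G x a b y) : IsGeodesic G y b a x where
  xa := h.yb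
  ab := by rw [SimpleGraph.dist_comm, h.ab]
  yb := h.xa
  xb := h.ya
  ya := h.xb
  xy := by rw [SimpleGraph.dist_comm, h.xy]

/-- The Schur complement of the matrix `2 D + I` with respect to a geodesic of length three is
negative definite. -/
theorem IsGeodesic.schur_neg [Fintype V] [DecidableEq V] {x a b y : V} (hp : IsGeodesic G x a b y)
    (hG : NegDefOnHyperplane (shiftedDist G)) {k : ℕ} (f : Fin k → V) (hf : Function.Injective f)
    (hfx : ∀ i, f i ≠ x ∧ f i ≠ a ∧ f i ≠ b ∧ f i ≠ y) (c : Fin k → ℤ) (hc : c ≠ 0) :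
    ∑ i, ∑ j, c i * c j * (15 * (2 * (G.dist (f i) (f j) : ℤ) + if i = j then 1 else 0)
      - pathForm (quad G x a b y (f i)) (quad G x a b y (f j))) < 0 := by
  obtain ⟨i₀, hi₀⟩ := Function.ne_iff.mp hc
  have hax : G.dist a x = 1 := by rw [SimpleGraph.dist_comm, hp.xa]
  have hba : G.dist b a = 1 := by rw [SimpleGraph.dist_comm, hp.ab]
  have hby : G.dist b y = 1 := by rw [SimpleGraph.dist_comm, hp.yb]
  have hbx : G.dist b x = 2 := by rw [SimpleGraph.dist_comm, hp.xb]
  have hay : G.dist a y = 2 := by rw [SimpleGraph.dist_comm, hp.ya]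
  have hyx : G.dist y x = 3 := by rw [SimpleGraph.dist_comm, hp.xy]
  have hne : ∀ {u v : V} {n : ℕ}, G.dist u v = n + 1 → u ≠ v := by
    rintro u v n h rfl
    simp at h
  have nxa := hne hp.xa
  have nab := hne hp.ab
  have nyb := hne hp.yb
  have nxb := hne hp.xb
  have nya := hne hp.ya
  have nxy := hne hp.xy
  set B := Matrix.toBilin' (shiftedDist G) with hB
  have hsingle : ∀ u v, B (Pi.single u 1) (Pi.single v 1) =
      2 * (G.dist u v : ℝ) + if u = v then 1 else 0 := fun u v => by
    rw [hB, Matrix.toBilin'_single, shiftedDist_apply]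
  obtain ⟨w, hw⟩ : ∃ w : V → V → ℝ, ∀ v, w v =
    (15 : ℝ) • Pi.single v 1
      - (2 * (-9 * (G.dist x v : ℝ) + 18 * G.dist a v - 12 * G.dist b v + 6 * G.dist y v)) •
        Pi.single x (1 : ℝ)
      - (2 * (18 * (G.dist x v : ℝ) - 41 * G.dist a v + 34 * G.dist b v - 12 * G.dist y v)) •
        Pi.single a (1 : ℝ)
      - (2 * (-12 * (G.dist x v : ℝ) + 34 * G.dist a v - 41 * G.dist b v + 18 * G.dist y v)) •
        Pi.single b (1 : ℝ)
      - (2 * (6 * (G.dist x v : ℝ) - 12 * G.dist a v + 18 * G.dist b v - 9 * G.dist y v)) •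
        Pi.single y (1 : ℝ) :=
    ⟨_, fun _ => rfl⟩
  have hwx : ∀ v, (v ≠ x ∧ v ≠ a ∧ v ≠ b ∧ v ≠ y) → B (Pi.single x 1) (w v) = 0 := by
    rintro v ⟨h1, h2, h3, h4⟩
    simp only [hw, map_sub, map_smul, smul_eq_mul, hsingle, hp.xa, hp.xb, hp.xy,
      SimpleGraph.dist_self, nxa, nxb, nxy, h1.symm, if_true, if_false]
    push_cast
    ring
  have hwa : ∀ v, (v ≠ x ∧ v ≠ a ∧ v ≠ b ∧ v ≠ y) → B (Pi.single a 1) (w v) = 0 := by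
    rintro v ⟨h1, h2, h3, h4⟩
    simp only [hw, map_sub, map_smul, smul_eq_mul, hsingle, hax, hp.ab, hay,
      SimpleGraph.dist_self, nxa.symm, nab, nya.symm, h2.symm, if_true, if_false]
    push_cast
    ring
  have hwb : ∀ v, (v ≠ x ∧ v ≠ a ∧ v ≠ b ∧ v ≠ y) → B (Pi.single b 1) (w v) = 0 := by
    rintro v ⟨h1, h2, h3, h4⟩
    simp only [hw, map_sub, map_smul, smul_eq_mul, hsingle, hbx, hba, hby,
      SimpleGraph.dist_self, nxb.symm, nab.symm, nyb.symm, h3.symm, if_true, if_false]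
    push_cast
    ring
  have hwy : ∀ v, (v ≠ x ∧ v ≠ a ∧ v ≠ b ∧ v ≠ y) → B (Pi.single y 1) (w v) = 0 := by
    rintro v ⟨h1, h2, h3, h4⟩
    simp only [hw, map_sub, map_smul, smul_eq_mul, hsingle, hyx, hp.ya, hp.yb,
      SimpleGraph.dist_self, nxy.symm, nya, nyb, h4.symm, if_true, if_false]
    push_cast
    ring
  have hww : ∀ u v, (u ≠ x ∧ u ≠ a ∧ u ≠ b ∧ u ≠ y) → (v ≠ x ∧ v ≠ a ∧ v ≠ b ∧ v ≠ y) →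
      B (w u) (w v) = 15 * (((15 * (2 * (G.dist u v : ℤ) + if u = v then 1 else 0)
        - pathForm (quad G x a b y u) (quad G x a b y v) : ℤ)) : ℝ) := by
    rintro u v hu hv
    have hstep : B (w u) (w v) = 15 * B (Pi.single u 1) (w v) := by
      conv_lhs => rw [hw u]
      simp only [map_sub, map_smul, LinearMap.sub_apply, LinearMap.smul_apply, hwx v hv, hwa v hv,
        hwb v hv, hwy v hv, smul_eq_mul, mul_zero, sub_zero]
    obtain ⟨h1, h2, h3, h4⟩ := hu
    rw [hstep]
    simp only [hw, map_sub, map_smul, smul_eq_mul, hsingle, h1, h2, h3, h4, if_false, pathForm, quad,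
      G.dist_comm (u := u) (v := x), G.dist_comm (u := u) (v := a),
      G.dist_comm (u := u) (v := b), G.dist_comm (u := u) (v := y)]
    push_cast
    ring
  have hz : (∑ i, (c i : ℝ) • w (f i)) ≠ 0 := by
    intro h0
    have h1 := congrFun h0 (f i₀)
    obtain ⟨g1, g2, g3, g4⟩ := hfx i₀
    simp only [Finset.sum_apply, hw, Pi.sub_apply, Pi.smul_apply, smul_eq_mul, Pi.single_apply,
      hf.eq_iff, g1, g2, g3, g4, if_false, mul_zero, sub_zero, Pi.zero_apply, mul_ite, mul_one,
      Finset.sum_ite_eq, Finset.mem_univ, if_true] at h1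
    simp at h1
    exact hi₀ h1
  have hneg := hG.neg_of_orthogonal (shiftedDist_isSymm G) (p := Pi.single x 1) (z := _)
    (by
      rw [← Matrix.toBilin'_apply', hsingle]
      simp) hz (by
      rw [← Matrix.toBilin'_apply', ← hB, map_sum]
      refine Finset.sum_eq_zero fun i _ => ?_
      rw [map_smul, hwx _ (hfx i), smul_zero])
  rw [← Matrix.toBilin'_apply', ← hB] at hneg
  simp only [map_sum, map_smul, LinearMap.sum_apply, LinearMap.smul_apply, smul_eq_mul] at hneg
  simp only [Finset.mul_sum] at hneg
  rw [Finset.sum_comm] at hneg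
  have hcast : (15 : ℝ) * ((∑ i, ∑ j, c i * c j *
      (15 * (2 * (G.dist (f i) (f j) : ℤ) + if i = j then 1 else 0)
      - pathForm (quad G x a b y (f i)) (quad G x a b y (f j))) : ℤ) : ℝ) < 0 := by
    refine lt_of_eq_of_lt ?_ hneg
    rw [Int.cast_sum, Finset.mul_sum]
    refine Finset.sum_congr rfl fun i _ => ?_
    rw [Int.cast_sum, Finset.mul_sum]
    refine Finset.sum_congr rfl fun j _ => ?_
    rw [hww _ _ (hfx _) (hfx _)]
    simp only [hf.eq_iff]
    push_cast
    ring
  have : ((∑ i, ∑ j, c i * c j *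
      (15 * (2 * (G.dist (f i) (f j) : ℤ) + if i = j then 1 else 0)
      - pathForm (quad G x a b y (f i)) (quad G x a b y (f j))) : ℤ) : ℝ) < 0 := by
    linarith
  exact_mod_cast this

end Path

section Quads

/-- Fifteen times a diagonal entry of the Schur complement. -/
abbrev schurDiag (s : Quad) : ℤ := 15 - pathForm s s

/-- Fifteen times an off-diagonal entry of the Schur complement. -/
abbrev schurOff (s t : Quad) (d : ℕ) : ℤ := 30 * d - pathForm s t

/-- All coordinates are positive: the vertex is not on the path. -/
abbrev OffPath (s : Quad) : Prop := s.1 ≠ 0 ∧ s.2.1 ≠ 0 ∧ s.2.2.1 ≠ 0 ∧ s.2.2.2 ≠ 0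

/-- The triangle inequalities for two vertices at distance `d` and a path vertex. -/
abbrev TriangleIneq (m n d : ℕ) : Prop := m ≤ n + d ∧ n ≤ m + d ∧ d ≤ m + n

/-- Necessary conditions for two vertices with given distances to the path to have distance `d`. -/
def Compat (s t : Quad) (d : ℕ) : Prop :=
  TriangleIneq s.1 t.1 d ∧ TriangleIneq s.2.1 t.2.1 d ∧ TriangleIneq s.2.2.1 t.2.2.1 d ∧
    TriangleIneq s.2.2.2 t.2.2.2 d ∧
    (OffPath s → OffPath t → schurOff s t d ^ 2 < schurDiag s * schurDiag t)

instance (s t : Quad) (d : ℕ) : Decidable (Compat s t d) := by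
  unfold Compat
  infer_instance

/-- The distances of the path vertices to the path. -/
abbrev pathQuads : List Quad := [(0, 1, 2, 3), (1, 0, 1, 2), (2, 1, 0, 1), (3, 2, 1, 0)]

/-- A central vertex is adjacent to both inner vertices of the path only. -/
abbrev central : Quad := (2, 1, 1, 2)

/-- A remote vertex is at distance two from the inner vertices and three from the outer ones. -/
abbrev remote : Quad := (3, 2, 2, 3)

/-- The distances to the path of the vertices with a neighbour on the path. -/
abbrev coreQuads : List Quad :=
  pathQuads ++ [(1, 1, 2, 3), (2, 1, 2, 3), (2, 1, 1, 2), (3, 2, 1, 1), (3, 2, 1, 2)]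

/-- All possible distances to the path. -/
abbrev allQuads : List Quad :=
  coreQuads ++ [(3, 2, 2, 3), (2, 2, 2, 2), (2, 2, 2, 3), (2, 2, 3, 3), (2, 3, 3, 3), (3, 2, 2, 2),
    (3, 3, 2, 2), (3, 3, 3, 2), (3, 3, 3, 3)]

theorem mem_allQuads_of_schurDiag_neg : ∀ p ∈ [1, 2, 3], ∀ q ∈ [1, 2, 3], ∀ r ∈ [1, 2, 3],
    ∀ s ∈ [1, 2, 3], p ≤ q + 1 → q ≤ p + 1 → q ≤ r + 1 → r ≤ q + 1 → r ≤ s + 1 → s ≤ r + 1 →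
    3 ≤ p + s → 2 ≤ p + r → 2 ≤ q + s → p ≤ r + 2 → s ≤ q + 2 →
    schurDiag (p, q, r, s) < 0 → (p, q, r, s) ∈ allQuads := by
  decide +kernel

end Quads

section Setting

variable {V : Type*} [Fintype V] [DecidableEq V] {G : SimpleGraph V} {x a b y : V}

/-- A geodesic of length three in a connected graph of diameter three whose second distance
eigenvalue is less than `-1/2`. -/
structure GoodGeodesic (G : SimpleGraph V) (x a b y : V) : Prop where
  conn : G.Connected
  form : NegDefOnHyperplane (shiftedDist G)
  le_three : ∀ u v, G.dist u v ≤ 3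
  geod : IsGeodesic G x a b y

namespace GoodGeodesic

variable (h : GoodGeodesic G x a b y)
include h

theorem symm : GoodGeodesic G y b a x := ⟨h.conn, h.form, h.le_three, h.geod.symm⟩

theorem quad_x : quad G x a b y x = (0, 1, 2, 3) := by
  simp [quad, G.dist_comm (u := a) (v := x), G.dist_comm (u := b) (v := x),
    G.dist_comm (u := y) (v := x), h.geod.xa, h.geod.xb, h.geod.xy]

theorem quad_a : quad G x a b y a = (1, 0, 1, 2) := by
  simp [quad, G.dist_comm (u := b) (v := a), h.geod.xa, h.geod.ab, h.geod.ya]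

theorem quad_b : quad G x a b y b = (2, 1, 0, 1) := by
  simp [quad, h.geod.xb, h.geod.ab, h.geod.yb]

theorem quad_y : quad G x a b y y = (3, 2, 1, 0) := by
  simp [quad, G.dist_comm (u := a) (v := y), G.dist_comm (u := b) (v := y), h.geod.xy,
    h.geod.ya, h.geod.yb]

theorem offPath_iff {v : V} :
    OffPath (quad G x a b y v) ↔ v ≠ x ∧ v ≠ a ∧ v ≠ b ∧ v ≠ y := by
  simp only [OffPath, quad, ne_eq, h.conn.dist_eq_zero_iff, eq_comm (a := v)]

theorem triangleIneq (p u v : V) : TriangleIneq (G.dist p u) (G.dist p v) (G.dist u v) := by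
  have h1 := h.conn.dist_triangle (u := p) (v := v) (w := u)
  have h2 := h.conn.dist_triangle (u := p) (v := u) (w := v)
  have h3 := h.conn.dist_triangle (u := u) (v := p) (w := v)
  rw [G.dist_comm (u := v) (v := u)] at h1
  rw [G.dist_comm (u := u) (v := p)] at h3
  exact ⟨h1, h2, h3⟩

theorem quad_mem (v : V) : quad G x a b y v ∈ allQuads := by
  by_cases hv : OffPath (quad G x a b y v)
  · have hneg := h.geod.schur_neg h.form ![v] (Function.injective_of_subsingleton _)
      (fun i => by simpa using h.offPath_iff.mp hv) ![1] (by simp)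
    simp only [Finset.univ_unique, Fin.default_eq_zero, Finset.sum_singleton, Matrix.cons_val_zero,
      SimpleGraph.dist_self] at hneg
    have hd : schurDiag (quad G x a b y v) < 0 := by
      simpa using hneg
    have hm : ∀ n ≤ 3, n ≠ 0 → n ∈ [1, 2, 3] := by decide
    obtain ⟨o1, o2, o3, o4⟩ := hv
    obtain ⟨p1, p2, p3, p4, p5, p6⟩ := h.geod
    have t1 := h.triangleIneq v x a
    have t2 := h.triangleIneq v a b
    have t3 := h.triangleIneq v y b
    have t4 := h.triangleIneq v x y
    have t5 := h.triangleIneq v x b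
    have t6 := h.triangleIneq v y a
    simp only [G.dist_comm (u := v)] at t1 t2 t3 t4 t5 t6
    unfold TriangleIneq at t1 t2 t3 t4 t5 t6
    exact mem_allQuads_of_schurDiag_neg _ (hm _ (h.le_three _ _) o1) _ (hm _ (h.le_three _ _) o2) _
      (hm _ (h.le_three _ _) o3) _ (hm _ (h.le_three _ _) o4) (by omega) (by omega) (by omega)
      (by omega) (by omega) (by omega) (by omega) (by omega) (by omega) (by omega) (by omega) hd
  · rw [h.offPath_iff] at hv
    have : v = x ∨ v = a ∨ v = b ∨ v = y := by tauto
    rcases this with rfl | rfl | rfl | rfl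
    · simp [h.quad_x]
    · simp [h.quad_a]
    · simp [h.quad_b]
    · simp [h.quad_y]

theorem compat {u v : V} (huv : u ≠ v) :
    Compat (quad G x a b y u) (quad G x a b y v) (G.dist u v) := by
  refine ⟨h.triangleIneq _ _ _, h.triangleIneq _ _ _, h.triangleIneq _ _ _,
    h.triangleIneq _ _ _, fun hu hv => ?_⟩
  set s := quad G x a b y u with hs
  set t := quad G x a b y v with ht
  have hfx : ∀ i, ![u, v] i ≠ x ∧ ![u, v] i ≠ a ∧ ![u, v] i ≠ b ∧ ![u, v] i ≠ y := by
    intro i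
    fin_cases i
    · exact h.offPath_iff.mp hu
    · exact h.offPath_iff.mp hv
  have hinj : Function.Injective ![u, v] := by
    intro i j
    fin_cases i <;> fin_cases j <;> simp [huv, huv.symm]
  have hsymm : pathForm t s = pathForm s t := by
    unfold pathForm
    ring
  have key : ∀ c : Fin 2 → ℤ, c ≠ 0 → c 0 ^ 2 * schurDiag s + 2 * (c 0 * c 1) *
      schurOff s t (G.dist u v) + c 1 ^ 2 * schurDiag t < 0 := by
    intro c hc
    have := h.geod.schur_neg h.form ![u, v] hinj hfx c hc
    simp [Fin.sum_univ_two, G.dist_comm (u := v) (v := u), ← hs, ← ht, hsymm] at this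
    unfold schurDiag schurOff
    linarith
  have h1 : schurDiag s < 0 := by simpa using key ![1, 0] (by simp)
  have h2 := key ![-schurOff s t (G.dist u v), schurDiag s] (by
    intro h0
    have := congrFun h0 1
    simp only [Matrix.cons_val_one, Matrix.cons_val_zero, Pi.zero_apply] at this
    omega)
  simp only [Matrix.cons_val_one, Matrix.cons_val_zero] at h2
  generalize schurDiag s = p at *
  generalize schurDiag t = q at *
  generalize schurOff s t (G.dist u v) = r at *
  have h3 : p * (p * q - r ^ 2) < 0 := by linarith
  nlinarith [pos_of_mul_neg_right h3 h1.le]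

theorem triple_neg {u v w : V} (huv : u ≠ v) (huw : u ≠ w) (hvw : v ≠ w)
    (hu : OffPath (quad G x a b y u)) (hv : OffPath (quad G x a b y v))
    (hw : OffPath (quad G x a b y w)) (c : Fin 3 → ℤ) (hc : c ≠ 0) :
    c 0 ^ 2 * schurDiag (quad G x a b y u) + c 1 ^ 2 * schurDiag (quad G x a b y v) +
      c 2 ^ 2 * schurDiag (quad G x a b y w) +
      2 * (c 0 * c 1 * schurOff (quad G x a b y u) (quad G x a b y v) (G.dist u v) +
        c 0 * c 2 * schurOff (quad G x a b y u) (quad G x a b y w) (G.dist u w) +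
        c 1 * c 2 * schurOff (quad G x a b y v) (quad G x a b y w) (G.dist v w)) < 0 := by
  have hfx : ∀ i, ![u, v, w] i ≠ x ∧ ![u, v, w] i ≠ a ∧ ![u, v, w] i ≠ b ∧ ![u, v, w] i ≠ y := by
    intro i
    fin_cases i
    · exact h.offPath_iff.mp hu
    · exact h.offPath_iff.mp hv
    · exact h.offPath_iff.mp hw
  have hinj : Function.Injective ![u, v, w] := by
    intro i j
    fin_cases i <;> fin_cases j <;> simp [huv, huv.symm, huw, huw.symm, hvw, hvw.symm]
  have hsymm : ∀ s t, pathForm t s = pathForm s t := fun s t => by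
    unfold pathForm
    ring
  have := h.geod.schur_neg h.form ![u, v, w] hinj hfx c hc
  simp [Fin.sum_univ_three, G.dist_comm (u := v) (v := u), G.dist_comm (u := w) (v := u),
    G.dist_comm (u := w) (v := v)] at this
  rw [hsymm (quad G x a b y u) (quad G x a b y v), hsymm (quad G x a b y u) (quad G x a b y w),
    hsymm (quad G x a b y v) (quad G x a b y w)] at this
  unfold schurDiag schurOff
  linarith

theorem central_quadruple_neg (f : Fin 4 → V) (hf : Function.Injective f)
    (hq : ∀ i, quad G x a b y (f i) = central) (c : Fin 4 → ℤ) (hc : c ≠ 0) :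
    ∑ i, ∑ j, c i * c j * (if i = j then (-25 : ℤ) else 30 * (G.dist (f i) (f j) : ℤ) - 40) < 0 := by
  have := h.geod.schur_neg h.form f hf (fun i => h.offPath_iff.mp (by rw [hq]; decide)) c hc
  refine lt_of_eq_of_lt (Finset.sum_congr rfl fun i _ => Finset.sum_congr rfl fun j _ => ?_) this
  have hp : pathForm central central = 40 := by decide
  rw [hq, hq, hp]
  split_ifs with hij
  · simp [hij]
  · ring

end GoodGeodesic
end Setting

section Setting

variable {V : Type*} [Fintype V] [DecidableEq V] {G : SimpleGraph V} {x a b y : V}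

namespace GoodGeodesic

variable (h : GoodGeodesic G x a b y)
include h

/-- Constraints on a pair of vertices that can be checked on their distances to the path. -/
theorem pair_constraint {P : ℕ → Prop} {u v : V} {s t : Quad} (huv : u ≠ v)
    (hu : quad G x a b y u = s) (hv : quad G x a b y v = t)
    (hP : ∀ d, d ≤ 3 → d ≠ 0 → Compat s t d → P d) : P (G.dist u v) := by
  have hc := h.compat huv
  rw [hu, hv] at hc
  exact hP _ (h.le_three _ _) (by rwa [ne_eq, h.conn.dist_eq_zero_iff]) hc

/-- Constraints on a triple of vertices off the path. -/
theorem triple_constraint {u v w : V} {s t r : Quad} (huv : u ≠ v) (huw : u ≠ w) (hvw : v ≠ w)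
    (hu : quad G x a b y u = s) (hv : quad G x a b y v = t) (hw : quad G x a b y w = r)
    (hs : OffPath s) (ht : OffPath t) (hr : OffPath r) (c : Fin 3 → ℤ) (hc : c ≠ 0) :
    c 0 ^ 2 * schurDiag s + c 1 ^ 2 * schurDiag t + c 2 ^ 2 * schurDiag r +
      2 * (c 0 * c 1 * schurOff s t (G.dist u v) + c 0 * c 2 * schurOff s r (G.dist u w) +
        c 1 * c 2 * schurOff t r (G.dist v w)) < 0 := by
  have := h.triple_neg huv huw hvw (by rwa [hu]) (by rwa [hv]) (by rwa [hw]) c hc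
  rwa [hu, hv, hw] at this

theorem adj_of_adj_remote {c r s : V} (hc : quad G x a b y c = central)
    (hr : quad G x a b y r = remote) (hs : quad G x a b y s = remote) (hcr : G.Adj c r)
    (hrs : G.Adj r s) : G.Adj c s := by
  have hcs : c ≠ s := by
    rintro rfl
    rw [hc] at hs
    exact absurd hs (by decide)
  have h1 := SimpleGraph.dist_eq_one_iff_adj.mpr hcr
  have h2 := SimpleGraph.dist_eq_one_iff_adj.mpr hrs
  by_contra hn
  have h3 : G.dist c s = 2 := by
    have ha := h.conn.dist_triangle (u := c) (v := r) (w := s)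
    have hb : G.dist c s ≠ 0 := by rwa [ne_eq, h.conn.dist_eq_zero_iff]
    have hd : G.dist c s ≠ 1 := by rwa [ne_eq, SimpleGraph.dist_eq_one_iff_adj]
    omega
  have := h.triple_constraint hcr.ne hcs hrs.ne hc hr hs (by decide) (by decide) (by decide)
    ![-1, 1, -1] (by decide)
  rw [h1, h2, h3] at this
  exact absurd this (by decide)

theorem dist_eq_two_of_central {c d : V} (hc : quad G x a b y c = central)
    (hd : quad G x a b y d = central) (hcd : c ≠ d) (hn : ¬ G.Adj c d) : G.dist c d = 2 := by
  have h1 : G.dist c d ≠ 1 := by rwa [ne_eq, SimpleGraph.dist_eq_one_iff_adj]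
  have h2 : G.dist c d = 1 ∨ G.dist c d = 2 :=
    h.pair_constraint (P := fun d => d = 1 ∨ d = 2) hcd hc hd (by decide)
  tauto

theorem not_adj_central_remote {c d r : V} (hc : quad G x a b y c = central)
    (hd : quad G x a b y d = central) (hr : quad G x a b y r = remote) (hcd : c ≠ d)
    (hn : ¬ G.Adj c d) : ¬ G.Adj c r := by
  intro hcr
  have hrd : r ≠ d := fun e =>
    absurd (show remote = central by rw [← hr, ← hd, e]) (by decide)
  have h1 := h.dist_eq_two_of_central hc hd hcd hn
  have h2 := SimpleGraph.dist_eq_one_iff_adj.mpr hcr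
  have h3 : G.dist d r ≠ 0 := by rw [ne_eq, h.conn.dist_eq_zero_iff]; exact hrd.symm
  have h4 := h.le_three d r
  have key := h.triple_constraint hcd hcr.ne hrd.symm hc hd hr (by decide) (by decide) (by decide)
  have k1 := key ![-1, -1, 1] (by decide)
  have k2 := key ![-2, -1, 1] (by decide)
  rw [h1, h2] at k1 k2
  generalize G.dist d r = n at *
  have : n = 1 ∨ n = 2 ∨ n = 3 := by omega
  rcases this with rfl | rfl | rfl
  · exact absurd k1 (by decide)
  · exact absurd k1 (by decide)
  · exact absurd k2 (by decide)

theorem eq_of_adj_remote {c d r : V} (hc : quad G x a b y c = central)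
    (hd : quad G x a b y d = central) (hr : quad G x a b y r = remote)
    (hcr : G.Adj c r) (hdr : G.Adj d r) : c = d := by
  by_contra hcd
  by_cases hadj : G.Adj c d
  · have := h.triple_constraint hcd hcr.ne hdr.ne hc hd hr (by decide) (by decide) (by decide)
      ![-1, -1, 1] (by decide)
    rw [SimpleGraph.dist_eq_one_iff_adj.mpr hadj, SimpleGraph.dist_eq_one_iff_adj.mpr hcr,
      SimpleGraph.dist_eq_one_iff_adj.mpr hdr] at this
    exact absurd this (by decide)
  · exact h.not_adj_central_remote hc hd hr hcd hadj hcr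

theorem remote_adj_of_common {c r s : V} (hc : quad G x a b y c = central)
    (hr : quad G x a b y r = remote) (hs : quad G x a b y s = remote)
    (hcr : G.Adj c r) (hcs : G.Adj c s) (hrs : r ≠ s) : G.Adj r s := by
  by_contra hn
  have h3 : G.dist r s = 2 := by
    have ha := h.conn.dist_triangle (u := r) (v := c) (w := s)
    rw [G.dist_comm (u := r) (v := c), SimpleGraph.dist_eq_one_iff_adj.mpr hcr,
      SimpleGraph.dist_eq_one_iff_adj.mpr hcs] at ha
    have hb : G.dist r s ≠ 0 := by rwa [ne_eq, h.conn.dist_eq_zero_iff]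
    have hd : G.dist r s ≠ 1 := by rwa [ne_eq, SimpleGraph.dist_eq_one_iff_adj]
    omega
  have := h.triple_constraint hcr.ne hcs.ne hrs hc hr hs (by decide) (by decide) (by decide)
    ![-4, 1, 1] (by decide)
  rw [SimpleGraph.dist_eq_one_iff_adj.mpr hcr, SimpleGraph.dist_eq_one_iff_adj.mpr hcs, h3] at this
  exact absurd this (by decide)

theorem central_adj_trans {c d e : V} (hc : quad G x a b y c = central)
    (hd : quad G x a b y d = central) (he : quad G x a b y e = central)
    (hcd : G.Adj c d) (hde : G.Adj d e) (hce : c ≠ e) : G.Adj c e := by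
  by_contra hn
  have := h.triple_constraint hcd.ne hce hde.ne hc hd he (by decide) (by decide) (by decide)
    ![-1, 1, -1] (by decide)
  rw [SimpleGraph.dist_eq_one_iff_adj.mpr hcd, SimpleGraph.dist_eq_one_iff_adj.mpr hde,
    h.dist_eq_two_of_central hc he hce hn] at this
  exact absurd this (by decide)

theorem central_adj_or {c d e : V} (hc : quad G x a b y c = central)
    (hd : quad G x a b y d = central) (he : quad G x a b y e = central)
    (hcd : c ≠ d) (hce : c ≠ e) (hde : d ≠ e) (hn : ¬ G.Adj c d) : G.Adj c e ∨ G.Adj d e := by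
  by_contra! hcon
  have := h.triple_constraint hcd hce hde hc hd he (by decide) (by decide) (by decide)
    ![-1, -1, -1] (by decide)
  rw [h.dist_eq_two_of_central hc hd hcd hn, h.dist_eq_two_of_central hc he hce hcon.1,
    h.dist_eq_two_of_central hd he hde hcon.2] at this
  exact absurd this (by decide)

/-- There are at most three central vertices unless they form a clique. -/
theorem central_card_le {c d e f : V} (hc : quad G x a b y c = central)
    (hd : quad G x a b y d = central) (he : quad G x a b y e = central)
    (hf : quad G x a b y f = central) (hcd : c ≠ d) (hce : c ≠ e) (hcf : c ≠ f) (hde : d ≠ e)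
    (hdf : d ≠ f) (hn : ¬ G.Adj c d) : e = f := by
  by_contra hef
  have hinj : ∀ u v w z : V, u ≠ v → u ≠ w → u ≠ z → v ≠ w → v ≠ z → w ≠ z →
      Function.Injective ![u, v, w, z] := by
    intro u v w z h1 h2 h3 h4 h5 h6 i j
    fin_cases i <;> fin_cases j <;>
      simp [h1, h2, h3, h4, h5, h6, h1.symm, h2.symm, h3.symm, h4.symm, h5.symm, h6.symm]
  have hfour : ∀ u v w z : V, quad G x a b y u = central → quad G x a b y v = central →
      quad G x a b y w = central → quad G x a b y z = central →
      ∀ i, quad G x a b y (![u, v, w, z] i) = central := by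
    intro u v w z h1 h2 h3 h4 i
    fin_cases i <;> assumption
  have one_three : ∀ u v w z : V, quad G x a b y u = central → quad G x a b y v = central →
      quad G x a b y w = central → quad G x a b y z = central → u ≠ v → u ≠ w → u ≠ z →
      v ≠ w → v ≠ z → w ≠ z → ¬ G.Adj u v → G.Adj v w → G.Adj v z → False := by
    intro u v w z hu hv hw hz h1 h2 h3 h4 h5 h6 nuv avw avz
    have awz := h.central_adj_trans hw hv hz avw.symm avz h6
    have nuw : ¬ G.Adj u w := fun hh => nuv (h.central_adj_trans hu hw hv hh avw.symm h1)
    have nuz : ¬ G.Adj u z := fun hh => nuv (h.central_adj_trans hu hz hv hh avz.symm h1)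
    have := h.central_quadruple_neg _ (hinj u v w z h1 h2 h3 h4 h5 h6)
      (hfour u v w z hu hv hw hz) ![-2, -1, -1, -1] (by decide)
    simp [Fin.sum_univ_four, G.dist_comm (u := v) (v := u), G.dist_comm (u := w) (v := u),
      G.dist_comm (u := z) (v := u), G.dist_comm (u := w) (v := v), G.dist_comm (u := z) (v := v),
      G.dist_comm (u := z) (v := w), h.dist_eq_two_of_central hu hv h1 nuv,
      h.dist_eq_two_of_central hu hw h2 nuw, h.dist_eq_two_of_central hu hz h3 nuz,
      SimpleGraph.dist_eq_one_iff_adj.mpr awz, SimpleGraph.dist_eq_one_iff_adj.mpr avw,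
      SimpleGraph.dist_eq_one_iff_adj.mpr avz] at this
  have two_two : ∀ u v w z : V, quad G x a b y u = central → quad G x a b y v = central →
      quad G x a b y w = central → quad G x a b y z = central → u ≠ v → u ≠ w → u ≠ z →
      v ≠ w → v ≠ z → w ≠ z → ¬ G.Adj u v → G.Adj u w → G.Adj v z → False := by
    intro u v w z hu hv hw hz h1 h2 h3 h4 h5 h6 nuv auw avz
    have nvw : ¬ G.Adj v w := fun hh => nuv (h.central_adj_trans hu hw hv auw hh.symm h1)
    have nuz : ¬ G.Adj u z := fun hh => nuv (h.central_adj_trans hu hz hv hh avz.symm h1)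
    have nwz : ¬ G.Adj w z := fun hh => nvw (h.central_adj_trans hv hz hw avz hh.symm h4)
    have := h.central_quadruple_neg _ (hinj u v w z h1 h2 h3 h4 h5 h6)
      (hfour u v w z hu hv hw hz) ![-1, -1, -1, -1] (by decide)
    simp [Fin.sum_univ_four, G.dist_comm (u := v) (v := u), G.dist_comm (u := w) (v := u),
      G.dist_comm (u := z) (v := u), G.dist_comm (u := w) (v := v), G.dist_comm (u := z) (v := v),
      G.dist_comm (u := z) (v := w), h.dist_eq_two_of_central hu hv h1 nuv,
      h.dist_eq_two_of_central hv hw h4 nvw, h.dist_eq_two_of_central hu hz h3 nuz,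
      h.dist_eq_two_of_central hw hz h6 nwz, SimpleGraph.dist_eq_one_iff_adj.mpr auw,
      SimpleGraph.dist_eq_one_iff_adj.mpr avz] at this
  rcases h.central_adj_or hc hd he hcd hce hde hn with h1 | h1 <;>
    rcases h.central_adj_or hc hd hf hcd hcf hdf hn with h2 | h2
  · exact one_three d c e f hd hc he hf hcd.symm hde hdf hce hcf hef (fun hh => hn hh.symm) h1 h2
  · exact two_two c d e f hc hd he hf hcd hce hcf hde hdf hef hn h1 h2
  · exact two_two d c e f hd hc he hf hcd.symm hde hdf hce hcf hef (fun hh => hn hh.symm) h1 h2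
  · exact one_three c d e f hc hd he hf hcd hce hcf hde hdf hef hn h1 h2

/-- Every vertex has a neighbour on the path, or is remote with a central neighbour. -/
theorem quad_mem_core_or (v : V) : quad G x a b y v ∈ coreQuads ∨
    quad G x a b y v = remote ∧ ∃ c, quad G x a b y c = central ∧ G.Adj c v := by
  by_contra hv
  obtain ⟨p⟩ := h.conn.preconnected x v
  obtain ⟨d, hd, h1, h2⟩ := p.exists_boundary_dart
    {v | quad G x a b y v ∈ coreQuads ∨
      quad G x a b y v = remote ∧ ∃ c, quad G x a b y c = central ∧ G.Adj c v}
    (by left; rw [h.quad_x]; decide) hv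
  have hadj := d.adj
  generalize d.fst = u at *
  generalize d.snd = w at *
  have hc := h.compat hadj.ne
  rw [SimpleGraph.dist_eq_one_iff_adj.mpr hadj] at hc
  have hw := h.quad_mem w
  simp only [Set.mem_ofPred_eq, not_or, not_and, not_exists] at h1 h2
  obtain ⟨h2, h3⟩ := h2
  rcases h1 with h1 | ⟨h1, c, hcc, hcu⟩
  · have key : ∀ s ∈ coreQuads, ∀ t ∈ allQuads, Compat s t 1 →
        t ∈ coreQuads ∨ (s = central ∧ t = remote) := by decide +kernel
    rcases key _ h1 _ hw hc with h4 | ⟨h4, h5⟩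
    · exact h2 h4
    · exact h3 h5 u h4 hadj
  · have key : ∀ t ∈ allQuads, Compat remote t 1 → t ∈ coreQuads ∨ t = remote := by decide +kernel
    rw [h1] at hc
    rcases key _ hw hc with h4 | h4
    · exact h2 h4
    · exact h3 h4 c hcc (h.adj_of_adj_remote hcc h1 h4 hcu hadj)

end GoodGeodesic
end Setting

section BlockGraph

variable {V : Type*} {G : SimpleGraph V}

theorem SimpleGraph.Walk.IsCycle.index_of_mem_edges {v : V} {c : G.Walk v v} (hc : c.IsCycle)
    {i j : ℕ} (hij : i < j) (hj : j < c.length)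
    (he : s(c.getVert i, c.getVert j) ∈ c.edges) : j = i + 1 ∨ i = 0 ∧ j + 1 = c.length := by
  obtain ⟨k, hk, hlt⟩ : ∃ k, s(c.getVert k, c.getVert (k + 1)) =
      s(c.getVert i, c.getVert j) ∧ k < c.length := by
    rw [← SimpleGraph.Walk.toSubgraph_adj_iff,
      SimpleGraph.Walk.adj_toSubgraph_iff_mem_edges]
    exact he
  have hinj : ∀ m n, m < c.length → n < c.length → c.getVert m = c.getVert n → m = n :=
    fun m n hm hn hmn => hc.getVert_injOn' (by simp only [Set.mem_ofPred_eq]; omega)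
      (by simp only [Set.mem_ofPred_eq]; omega) hmn
  rcases Sym2.eq_iff.mp hk with ⟨h1, h2⟩ | ⟨h1, h2⟩
  · have := hinj _ _ hlt (by omega) h1
    subst this
    exact Or.inl (hinj _ _ (by omega) hj h2).symm
  · have := hinj _ _ hlt hj h1
    subst this
    rcases Nat.lt_or_ge (k + 1) c.length with h3 | h3
    · have := hinj _ _ h3 (by omega) h2
      omega
    · have h4 : k + 1 = c.length := by omega
      have h5 : c.getVert 0 = c.getVert i := by
        rw [c.getVert_zero, ← h2, h4, c.getVert_length]
      have := hinj _ _ (by omega) (by omega) h5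
      omega

/-- A graph is chordal if all vertices outside some clique are simplicial. -/
theorem isChordal_of_isClique [DecidableEq V] {K : Set V} (hK : G.IsClique K)
    (hs : ∀ v ∉ K, IsSimplicial G v) : IsChordal G := by
  intro v c hc hlen
  by_contra! hno
  have hmem : ∀ u ∈ c.support, u ∈ K := by
    intro u hu
    by_contra huK
    set d := c.rotate u hu with hd
    have hdc : d.IsCycle := (SimpleGraph.Walk.isCycle_rotate hu).mpr hc
    have hdl : d.length = c.length := c.length_rotate u hu
    have hn := hdc.not_nil
    have hedge := hno (d.getVert 1) (d.getVert (d.length - 1))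
      ((c.mem_support_rotate_iff u hu).mp (d.getVert_mem_support _))
      ((c.mem_support_rotate_iff u hu).mp (d.getVert_mem_support _))
      (hs u huK (d.adj_snd hn) (d.adj_penultimate hn).symm hdc.snd_ne_penultimate)
    have hedge' := (c.rotate_edges u hu).mem_iff.mpr hedge
    have := hdc.index_of_mem_edges (i := 1) (j := d.length - 1) (by omega) (by omega) hedge'
    omega
  have hne : c.getVert 0 ≠ c.getVert 2 := fun he => by
    have := hc.getVert_injOn' (by simp) (by simp only [Set.mem_ofPred_eq]; omega) he
    omega
  have := hc.index_of_mem_edges (i := 0) (j := 2) (by omega) (by omega)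
    (hno _ _ (c.getVert_mem_support _) (c.getVert_mem_support _)
      (hK (hmem _ (c.getVert_mem_support _)) (hmem _ (c.getVert_mem_support _)) hne))
  omega

theorem not_hasInducedSubgraph_diamond_of_isClique {K : Set V} (hK : G.IsClique K)
    (hs : ∀ v ∉ K, IsSimplicial G v)
    (hu : ∀ v ∉ K, ∀ p ∈ K, ∀ q ∈ K, G.Adj v p → G.Adj v q → p = q) :
    ¬ HasInducedSubgraph G diamondGraph := by
  rintro ⟨s, ⟨e⟩⟩
  let f : Fin 4 → V := fun i => (e.symm i : V)
  have hf : Function.Injective f := fun i j hij => e.symm.injective (Subtype.ext hij)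
  have hadj : ∀ i j, G.Adj (f i) (f j) ↔ diamondGraph.Adj i j := fun i j => by
    rw [← e.symm.map_adj_iff]
    rfl
  have h02 : G.Adj (f 0) (f 2) := (hadj _ _).mpr (by simp [diamondGraph])
  have h03 : G.Adj (f 0) (f 3) := (hadj _ _).mpr (by simp [diamondGraph])
  have h12 : G.Adj (f 1) (f 2) := (hadj _ _).mpr (by simp [diamondGraph])
  have h13 : G.Adj (f 1) (f 3) := (hadj _ _).mpr (by simp [diamondGraph])
  have h23 : ¬ G.Adj (f 2) (f 3) := fun h => by
    have := (hadj _ _).mp h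
    simp [diamondGraph] at this
  have hne : f 2 ≠ f 3 := hf.ne (by decide)
  have hmem : ∀ v, G.Adj v (f 2) → G.Adj v (f 3) → v ∈ K := fun v h2 h3 => by
    by_contra hv
    exact h23 (hs v hv h2 h3 hne)
  have h0 := hmem _ h02 h03
  have h1 := hmem _ h12 h13
  have h01 : f 0 ≠ f 1 := hf.ne (by decide)
  by_cases h2 : f 2 ∈ K
  · by_cases h3 : f 3 ∈ K
    · exact h23 (hK h2 h3 hne)
    · exact h01 (hu _ h3 _ h0 _ h1 h03.symm h13.symm)
  · exact h01 (hu _ h2 _ h0 _ h1 h02.symm h12.symm)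

end BlockGraph

/-- The vertices `a`, `b` and the central vertices. -/
abbrev hubQuads : List Quad := [(1, 0, 1, 2), (2, 1, 0, 1), (2, 1, 1, 2)]

section Setting

variable {V : Type*} [Fintype V] [DecidableEq V] {G : SimpleGraph V} {x a b y : V}

namespace GoodGeodesic

variable (h : GoodGeodesic G x a b y)
include h

theorem isBlock_of_central_clique (hC : ∀ c d, quad G x a b y c = central →
    quad G x a b y d = central → c ≠ d → G.Adj c d) :
    IsChordal G ∧ ¬ HasInducedSubgraph G diamondGraph := by
  have hcompat : ∀ {u v}, G.Adj u v → Compat (quad G x a b y u) (quad G x a b y v) 1 :=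
    fun {u v} huv => by
      have := h.compat huv.ne
      rwa [SimpleGraph.dist_eq_one_iff_adj.mpr huv] at this
  have hdist : ∀ {u v : V}, u ≠ v → G.dist u v ≤ 3 ∧ G.dist u v ≠ 0 := fun {u v} huv =>
    ⟨h.le_three _ _, by rwa [ne_eq, h.conn.dist_eq_zero_iff]⟩
  have hmem : ∀ v, quad G x a b y v ∈ coreQuads ++ [remote] := fun v => by
    rcases h.quad_mem_core_or v with hv | ⟨hv, -⟩
    · exact List.mem_append_left _ hv
    · rw [hv]
      decide
  have hK : G.IsClique {v | quad G x a b y v ∈ hubQuads} := by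
    intro u hu v hv huv
    have key : ∀ s ∈ hubQuads, ∀ t ∈ hubQuads, (s ≠ central ∨ t ≠ central) →
        ∀ d, d ≤ 3 → d ≠ 0 → Compat s t d → d = 1 := by decide +kernel
    by_cases hc : quad G x a b y u = central ∧ quad G x a b y v = central
    · exact hC u v hc.1 hc.2 huv
    · exact SimpleGraph.dist_eq_one_iff_adj.mp (key _ hu _ hv (by tauto) _ (hdist huv).1
        (hdist huv).2 (h.compat huv))
  have hs : ∀ v ∉ {v | quad G x a b y v ∈ hubQuads}, IsSimplicial G v := by
    intro v hv u hu w hw huw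
    rw [SimpleGraph.mem_neighborSet] at hu hw
    rcases h.quad_mem_core_or v with hq | ⟨hq, c, hc, hcv⟩
    · have key : ∀ s ∈ coreQuads, s ∉ hubQuads → ∀ t ∈ coreQuads ++ [remote], Compat s t 1 →
          ∀ r ∈ coreQuads ++ [remote], Compat s r 1 →
          ∀ d, d ≤ 3 → d ≠ 0 → Compat t r d → d = 1 := by decide +kernel
      exact SimpleGraph.dist_eq_one_iff_adj.mp (key _ hq hv _ (hmem u) (hcompat hu) _ (hmem w)
        (hcompat hw) _ (hdist huw).1 (hdist huw).2 (h.compat huw))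
    · have key : ∀ t ∈ coreQuads ++ [remote], Compat remote t 1 → t = central ∨ t = remote := by
        decide +kernel
      have hcu := hcompat hu
      have hcw := hcompat hw
      rw [hq] at hcu hcw
      rcases key _ (hmem u) hcu with hu' | hu' <;> rcases key _ (hmem w) hcw with hw' | hw'
      · exact absurd (h.eq_of_adj_remote hu' hw' hq hu.symm hw.symm) huw
      · exact h.adj_of_adj_remote hu' hq hw' hu.symm hw
      · exact (h.adj_of_adj_remote hw' hq hu' hw.symm hu).symm
      · exact h.remote_adj_of_common hc hu' hw' (h.adj_of_adj_remote hc hq hu' hcv hu)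
          (h.adj_of_adj_remote hc hq hw' hcv hw) huw
  refine ⟨isChordal_of_isClique hK hs, not_hasInducedSubgraph_diamond_of_isClique hK hs ?_⟩
  intro v hv p hp q hq hvp hvq
  by_contra hpq
  rcases h.quad_mem_core_or v with hcore | ⟨hr, -⟩
  · have key : ∀ s ∈ coreQuads, s ∉ hubQuads → ∀ t ∈ hubQuads, Compat s t 1 →
        ∀ r ∈ hubQuads, Compat s r 1 → ∀ d, d ≤ 3 → d ≠ 0 → ¬ Compat t r d := by decide +kernel
    exact key _ hcore hv _ hp (hcompat hvp) _ hq (hcompat hvq) _ (hdist hpq).1 (hdist hpq).2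
      (h.compat hpq)
  · have key : ∀ t ∈ hubQuads, Compat remote t 1 → t = central := by decide +kernel
    have hcp := hcompat hvp
    have hcq := hcompat hvq
    rw [hr] at hcp hcq
    exact hpq (h.eq_of_adj_remote (key _ hp hcp) (key _ hq hcq) hr hvp.symm hvq.symm)

end GoodGeodesic
end Setting

section Typing

/-- Adjacency of the seven types of vertices of a blow-up. Types `0` and `1` are the inner
vertices of the path, `2` and `3` are the central vertices, `4` are the vertices hanging at `0`,
and `5` and `6` are the vertices hanging at `1`. -/
def TypeAdj (s t : Fin 7) : Prop :=
  s = t ∨ (s, t) ∈ [((0 : Fin 7), (1 : Fin 7)), (0, 2), (0, 3), (0, 4), (1, 2), (1, 3), (1, 5),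
    (1, 6)] ∨ (t, s) ∈ [((0 : Fin 7), (1 : Fin 7)), (0, 2), (0, 3), (0, 4), (1, 2), (1, 3), (1, 5),
    (1, 6)]

instance (s t : Fin 7) : Decidable (TypeAdj s t) := by
  unfold TypeAdj
  infer_instance

/-- The graph `G` is a blow-up into cliques of the graph of types. -/
def IsTyping {V : Type*} (G : SimpleGraph V) (τ : V → Fin 7) : Prop :=
  ∀ u v, G.Adj u v ↔ u ≠ v ∧ TypeAdj (τ u) (τ v)

/-- Class sizes of the typing of `Pt1Graph`. -/
def pt1Size : Fin 7 → ℕ := ![1, 1, 1, 2, 1, 1, 2]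

/-- Class sizes of the typing of `Pt2Graph p q`. -/
def pt2Size (p q : ℕ) : Fin 7 → ℕ := ![1, 1, 1, 2, p - 1, q - 1, 0]

/-- The number of vertices of a given type. -/
def typeCount {V : Type*} [Fintype V] (τ : V → Fin 7) (t : Fin 7) : ℕ :=
  (Finset.univ.filter fun v => τ v = t).card

theorem IsTyping.swap {V : Type*} {G : SimpleGraph V} {τ : V → Fin 7} (h : IsTyping G τ) :
    IsTyping G fun v => Equiv.swap 5 6 (τ v) := by
  intro u v
  rw [h u v]
  have : ∀ s t : Fin 7, TypeAdj s t ↔ TypeAdj (Equiv.swap 5 6 s) (Equiv.swap 5 6 t) := by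
    decide +kernel
  rw [this]

theorem typeCount_swap {V : Type*} [Fintype V] (τ : V → Fin 7) (t : Fin 7) :
    typeCount (fun v => Equiv.swap 5 6 (τ v)) t = typeCount τ (Equiv.swap 5 6 t) := by
  unfold typeCount
  congr 1
  ext v
  simp only [Finset.mem_filter, Finset.mem_univ, true_and]
  exact Equiv.swap_apply_eq_iff

/-- The type of a vertex with given distances to the path. -/
def coreType (s : Quad) : Fin 7 :=
  if s = (1, 0, 1, 2) then 0 else if s = (2, 1, 0, 1) then 1 else if s = central then 3
  else if s.1 ≤ 1 then 4 else if s.2.2.2 ≤ 1 then 5 else 6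

/-- The core distances, without the neighbours of `a` at distance two from `x`. -/
abbrev leftReducedQuads : List Quad :=
  pathQuads ++ [(1, 1, 2, 3), (2, 1, 1, 2), (3, 2, 1, 1), (3, 2, 1, 2)]

set_option synthInstance.maxSize 1000 in
set_option synthInstance.maxHeartbeats 200000 in
theorem compat_leftReduced : ∀ s ∈ leftReducedQuads, ∀ t ∈ leftReducedQuads,
    (s ≠ central ∨ t ≠ central) → ∀ d, d ≤ 3 → d ≠ 0 → Compat s t d →
    (d = 1 ↔ TypeAdj (coreType s) (coreType t)) ∧
    (s = central → (d = 1 ↔ TypeAdj 2 (coreType t))) ∧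
    (t = central → (d = 1 ↔ TypeAdj (coreType s) 2)) := by
  decide +kernel

set_option synthInstance.maxSize 1000 in
set_option synthInstance.maxHeartbeats 200000 in
theorem coreType_leftReduced : ∀ s ∈ leftReducedQuads,
    (coreType s = 0 → s = (1, 0, 1, 2)) ∧ (coreType s = 1 → s = (2, 1, 0, 1)) ∧
    coreType s ≠ 2 ∧ (coreType s = 3 → s = central) ∧
    (coreType s = 4 → s = (0, 1, 2, 3) ∨ s = (1, 1, 2, 3)) ∧
    (coreType s = 5 → s = (3, 2, 1, 0) ∨ s = (3, 2, 1, 1)) ∧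
    (coreType s = 6 → s = (3, 2, 1, 2)) := by
  decide +kernel

end Typing

section Setting

variable {V : Type*} [Fintype V] [DecidableEq V] {G : SimpleGraph V} {x a b y : V}

namespace GoodGeodesic

variable (h : GoodGeodesic G x a b y)
include h

theorem exists_typing_of_reduced {c d : V} (hc : quad G x a b y c = central)
    (hd : quad G x a b y d = central) (hcd : c ≠ d) (hn : ¬ G.Adj c d)
    (hdom : ∀ e, quad G x a b y e = central → e ≠ c → e ≠ d → G.Adj d e)
    (hred : ∀ v, quad G x a b y v ∈ leftReducedQuads) :
    ∃ τ, IsTyping G τ ∧ ((∀ t, typeCount τ t ≤ pt1Size t) ∨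
      ∃ p q, 2 ≤ p ∧ 2 ≤ q ∧ ∀ t, typeCount τ t ≤ pt2Size p q t) := by
  set Q := quad G x a b y with hQ
  have hcN : ∀ e, Q e = central → e ≠ c → ¬ G.Adj c e := by
    intro e he hec hce
    by_cases hed : e = d
    · exact hn (hed ▸ hce)
    · exact hn (h.central_adj_trans hc he hd hce (hdom e he hec hed).symm hcd)
  have hrest : ∀ e f, Q e = central → Q f = central → e ≠ c → f ≠ c → e ≠ f → G.Adj e f := by
    intro e f he hf hec hfc hef
    by_cases hed : e = d
    · subst hed
      exact hdom f hf hfc hef.symm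
    · by_cases hfd : f = d
      · subst hfd
        exact (hdom e he hec hef).symm
      · exact h.central_adj_trans he hd hf (hdom e he hec hed).symm (hdom f hf hfc hfd) hef
  have hpath : ∀ v, (Q v = (0, 1, 2, 3) → v = x) ∧ (Q v = (1, 0, 1, 2) → v = a) ∧
      (Q v = (2, 1, 0, 1) → v = b) ∧ (Q v = (3, 2, 1, 0) → v = y) := by
    intro v
    simp only [hQ, quad, Prod.mk.injEq]
    exact ⟨fun hh => (h.conn.dist_eq_zero_iff.mp hh.1).symm,
      fun hh => (h.conn.dist_eq_zero_iff.mp hh.2.1).symm,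
      fun hh => (h.conn.dist_eq_zero_iff.mp hh.2.2.1).symm,
      fun hh => (h.conn.dist_eq_zero_iff.mp hh.2.2.2).symm⟩
  obtain ⟨τ, hτ⟩ : ∃ τ : V → Fin 7, ∀ v, τ v = if v = c then 2 else coreType (Q v) :=
    ⟨_, fun _ => rfl⟩
  have htyp : IsTyping G τ := by
    intro u v
    rcases eq_or_ne u v with rfl | huv
    · simp
    simp only [ne_eq, huv, not_false_eq_true, true_and]
    have key := compat_leftReduced
    by_cases hcc : Q u = central ∧ Q v = central
    · obtain ⟨hu, hv⟩ := hcc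
      have h3 : coreType central = 3 := by decide
      rw [hτ, hτ, hu, hv, h3]
      split_ifs with huc hvc hvc
      · exact absurd (huc.trans hvc.symm) huv
      · subst huc
        exact iff_of_false (hcN v hv hvc) (by decide)
      · subst hvc
        exact iff_of_false (fun hh => hcN u hu huc hh.symm) (by decide)
      · exact iff_of_true (hrest u v hu hv huc hvc huv) (by decide)
    · obtain ⟨k1, k2, k3⟩ := key _ (hred u) _ (hred v) (by tauto) _ (h.le_three u v)
        (by rwa [ne_eq, h.conn.dist_eq_zero_iff]) (h.compat huv)
      rw [← SimpleGraph.dist_eq_one_iff_adj, hτ, hτ]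
      split_ifs with huc hvc hvc
      · exact absurd (huc.trans hvc.symm) huv
      · subst huc
        exact k2 hc
      · subst hvc
        exact k3 hc
      · exact k1
  have hcoreType := coreType_leftReduced
  have hmem : ∀ v t, t ≠ 2 → τ v = t → coreType (Q v) = t ∧ v ≠ c := by
    intro v t ht hv
    rw [hτ] at hv
    split_ifs at hv with hvc
    · exact absurd hv.symm ht
    · exact ⟨hv, hvc⟩
  have h0 : typeCount τ 0 ≤ 1 := Finset.card_le_one_iff.mpr fun {u v} hu hv => by
    simp only [Finset.mem_filter, Finset.mem_univ, true_and] at hu hv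
    rw [(hpath u).2.1 ((hcoreType _ (hred u)).1 (hmem u 0 (by decide) hu).1),
      (hpath v).2.1 ((hcoreType _ (hred v)).1 (hmem v 0 (by decide) hv).1)]
  have h1 : typeCount τ 1 ≤ 1 := Finset.card_le_one_iff.mpr fun {u v} hu hv => by
    simp only [Finset.mem_filter, Finset.mem_univ, true_and] at hu hv
    rw [(hpath u).2.2.1 ((hcoreType _ (hred u)).2.1 (hmem u 1 (by decide) hu).1),
      (hpath v).2.2.1 ((hcoreType _ (hred v)).2.1 (hmem v 1 (by decide) hv).1)]
  have h2 : typeCount τ 2 ≤ 1 := Finset.card_le_one_iff.mpr fun {u v} hu hv => by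
    simp only [Finset.mem_filter, Finset.mem_univ, true_and, hτ] at hu hv
    split_ifs at hu hv with huc hvc hvc
    · rw [huc, hvc]
    · exact absurd hv (hcoreType _ (hred v)).2.2.1
    · exact absurd hu (hcoreType _ (hred u)).2.2.1
    · exact absurd hu (hcoreType _ (hred u)).2.2.1
  have h3 : typeCount τ 3 ≤ 2 := by
    have hle : ((Finset.univ.filter fun v => τ v = 3).erase d).card ≤ 1 := by
      refine Finset.card_le_one_iff.mpr fun {u v} hu hv => ?_
      simp only [Finset.mem_erase, Finset.mem_filter, Finset.mem_univ, true_and] at hu hv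
      obtain ⟨hu1, hu2⟩ := hmem u 3 (by decide) hu.2
      obtain ⟨hv1, hv2⟩ := hmem v 3 (by decide) hv.2
      exact h.central_card_le hc hd ((hcoreType _ (hred u)).2.2.2.1 hu1)
        ((hcoreType _ (hred v)).2.2.2.1 hv1) hcd hu2.symm hv2.symm hu.1.symm hv.1.symm hn
    have := Finset.pred_card_le_card_erase (s := Finset.univ.filter fun v => τ v = 3) (a := d)
    unfold typeCount
    omega
  by_cases h6 : typeCount τ 6 = 0
  · refine ⟨τ, htyp, Or.inr ⟨typeCount τ 4 + 2, typeCount τ 5 + 2, by omega, by omega, ?_⟩⟩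
    intro t
    fin_cases t <;> simp [pt2Size] <;> omega
  have hsix : ∀ v, τ v = 6 → Q v = (3, 2, 1, 2) := fun v hv =>
    (hcoreType _ (hred v)).2.2.2.2.2.2 (hmem v 6 (by decide) hv).1
  obtain ⟨w, hw⟩ := Finset.card_pos.mp (Nat.pos_of_ne_zero h6)
  simp only [Finset.mem_filter, Finset.mem_univ, true_and] at hw
  replace hw := hsix w hw
  have hpair : ∀ {u v : V} {s t : Quad} (P : ℕ → Prop), u ≠ v → Q u = s → Q v = t →
      (∀ d, d ≤ 3 → d ≠ 0 → Compat s t d → P d) → P (G.dist u v) :=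
    fun P huv hu hv hP => h.pair_constraint huv hu hv hP
  have hne : ∀ {u v : V} {s t : Quad}, Q u = s → Q v = t → s ≠ t → u ≠ v := by
    rintro u v s t rfl rfl hst rfl
    exact hst rfl
  have h4 : typeCount τ 4 ≤ 1 := Finset.card_le_one_iff.mpr fun {u v} hu hv => by
    simp only [Finset.mem_filter, Finset.mem_univ, true_and] at hu hv
    have hx : ∀ v, τ v = 4 → v = x := by
      intro v hv
      rcases (hcoreType _ (hred v)).2.2.2.2.1 (hmem v 4 (by decide) hv).1 with h5 | h5
      · exact (hpath v).1 h5
      · exact (hpair (fun _ => False) (hne h5 hw (by decide)) h5 hw (by decide +kernel)).elim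
    rw [hx u hu, hx v hv]
  have dYY' : ∀ {u v}, Q u = (3, 2, 1, 1) → Q v = (3, 2, 1, 2) → G.dist u v = 2 :=
    fun {u v} hu hv => hpair (· = 2) (hne hu hv (by decide)) hu hv (by decide +kernel)
  have dY'Y' : ∀ {u v}, u ≠ v → Q u = (3, 2, 1, 2) → Q v = (3, 2, 1, 2) → G.dist u v = 1 :=
    fun {u v} huv hu hv => hpair (· = 1) huv hu hv (by decide +kernel)
  have dYY : ∀ {u v}, u ≠ v → Q u = (3, 2, 1, 1) → Q v = (3, 2, 1, 1) → G.dist u v = 1 :=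
    fun {u v} huv hu hv => hpair (· = 1) huv hu hv (by decide +kernel)
  have hfive : ∀ v, τ v = 5 → v ≠ y → Q v = (3, 2, 1, 1) := fun v hv hvy =>
    ((hcoreType _ (hred v)).2.2.2.2.2.1 (hmem v 5 (by decide) hv).1).resolve_left
      fun hh => hvy ((hpath v).2.2.2 hh)
  by_cases hY : ∃ z, Q z = (3, 2, 1, 1)
  · obtain ⟨z, hz⟩ := hY
    have h6' : typeCount τ 6 ≤ 1 := Finset.card_le_one_iff.mpr fun {u v} hu hv => by
      simp only [Finset.mem_filter, Finset.mem_univ, true_and] at hu hv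
      replace hu := hsix u hu
      replace hv := hsix v hv
      by_contra huv
      have := h.triple_constraint (hne hz hu (by decide)) (hne hz hv (by decide)) huv hz hu hv
        (by decide) (by decide) (by decide) ![-1, -1, -1] (by decide)
      rw [dYY' hz hu, dYY' hz hv, dY'Y' huv hu hv] at this
      exact absurd this (by decide)
    have h5' : typeCount τ 5 ≤ 2 := by
      have hle : ((Finset.univ.filter fun v => τ v = 5).erase y).card ≤ 1 := by
        refine Finset.card_le_one_iff.mpr fun {u v} hu hv => ?_
        simp only [Finset.mem_erase, Finset.mem_filter, Finset.mem_univ, true_and] at hu hv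
        have hu1 := hfive u hu.2 hu.1
        have hv1 := hfive v hv.2 hv.1
        by_contra huv
        have := h.triple_constraint huv (hne hu1 hw (by decide)) (hne hv1 hw (by decide))
          hu1 hv1 hw (by decide) (by decide) (by decide) ![-1, -1, -2] (by decide)
        rw [dYY huv hu1 hv1, dYY' hu1 hw, dYY' hv1 hw] at this
        exact absurd this (by decide)
      have := Finset.pred_card_le_card_erase (s := Finset.univ.filter fun v => τ v = 5) (a := y)
      unfold typeCount
      omega
    refine ⟨_, htyp.swap, Or.inl fun t => ?_⟩
    rw [typeCount_swap]
    fin_cases t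
    · exact h0
    · exact h1
    · exact h2
    · exact h3
    · exact h4
    · exact h6'
    · exact h5'
  · have h5' : typeCount τ 5 ≤ 1 := Finset.card_le_one_iff.mpr fun {u v} hu hv => by
      simp only [Finset.mem_filter, Finset.mem_univ, true_and] at hu hv
      have hy : ∀ v, τ v = 5 → v = y := fun v hv => by
        by_contra hvy
        exact hY ⟨v, hfive v hv hvy⟩
      rw [hy u hu, hy v hv]
    have h6' : typeCount τ 6 ≤ 2 := by
      by_contra! hlt
      obtain ⟨u, v, z, hu, hv, hz, huv, huz, hvz⟩ := Finset.two_lt_card_iff.mp hlt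
      simp only [Finset.mem_filter, Finset.mem_univ, true_and] at hu hv hz
      replace hu := hsix u hu
      replace hv := hsix v hv
      replace hz := hsix z hz
      have := h.triple_constraint huv huz hvz hu hv hz (by decide) (by decide) (by decide)
        ![-1, -1, -1] (by decide)
      rw [dY'Y' huv hu hv, dY'Y' huz hu hz, dY'Y' hvz hv hz] at this
      exact absurd this (by decide)
    refine ⟨τ, htyp, Or.inl fun t => ?_⟩
    fin_cases t
    · exact h0
    · exact h1
    · exact h2
    · exact h3
    · exact h4
    · exact h5'
    · exact h6'

theorem exists_typing (hnb : ¬ (IsChordal G ∧ ¬ HasInducedSubgraph G diamondGraph)) :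
    ∃ τ, IsTyping G τ ∧ ((∀ t, typeCount τ t ≤ pt1Size t) ∨
      ∃ p q, 2 ≤ p ∧ 2 ≤ q ∧ ∀ t, typeCount τ t ≤ pt2Size p q t) := by
  obtain ⟨c, d, hc, hd, hcd, hn⟩ : ∃ c d, quad G x a b y c = central ∧
      quad G x a b y d = central ∧ c ≠ d ∧ ¬ G.Adj c d := by
    by_contra! hcon
    exact hnb (h.isBlock_of_central_clique hcon)
  have hcore : ∀ v, quad G x a b y v ∈ coreQuads := by
    intro v
    rcases h.quad_mem_core_or v with hv | ⟨hv, e, he, hev⟩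
    · exact hv
    · exfalso
      by_cases hec : e = c
      · subst hec
        exact h.not_adj_central_remote he hd hv hcd hn hev
      · by_cases hce : G.Adj e c
        · have hed : e ≠ d := by
            rintro rfl
            exact hn hce.symm
          exact h.not_adj_central_remote he hd hv hed
            (fun hh => hn (h.central_adj_trans hc he hd hce.symm hh hcd)) hev
        · exact h.not_adj_central_remote he hc hv hec hce hev
  obtain ⟨c, d, hc, hd, hcd, hn, hdom⟩ : ∃ c d, quad G x a b y c = central ∧
      quad G x a b y d = central ∧ c ≠ d ∧ ¬ G.Adj c d ∧
      ∀ e, quad G x a b y e = central → e ≠ c → e ≠ d → G.Adj d e := by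
    by_cases hall : ∀ e, quad G x a b y e = central → e ≠ c → e ≠ d → G.Adj d e
    · exact ⟨c, d, hc, hd, hcd, hn, hall⟩
    · push Not at hall
      obtain ⟨e, he, hec, hed, hde⟩ := hall
      have hce := (h.central_adj_or hc hd he hcd hec.symm hed.symm hn).resolve_right hde
      refine ⟨d, c, hd, hc, hcd.symm, fun hh => hn hh.symm, fun f hf hfd hfc => ?_⟩
      rw [← h.central_card_le hc hd he hf hcd hec.symm hfc.symm hed.symm hfd.symm hn]
      exact hce
  by_cases hX' : ∃ u, quad G x a b y u = (2, 1, 2, 3)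
  · obtain ⟨u, hu⟩ := hX'
    have hrev : ∀ v, quad G y b a x v = ((quad G x a b y v).2.2.2, (quad G x a b y v).2.2.1,
        (quad G x a b y v).2.1, (quad G x a b y v).1) := fun v => rfl
    have hcen : ∀ v, quad G y b a x v = central ↔ quad G x a b y v = central := fun v => by
      simp only [hrev, Prod.ext_iff]
      tauto
    refine h.symm.exists_typing_of_reduced ((hcen c).mpr hc) ((hcen d).mpr hd) hcd hn
      (fun e he => hdom e ((hcen e).mp he)) fun v => ?_
    have hne : quad G x a b y v ≠ (3, 2, 1, 2) := fun hv =>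
      h.pair_constraint (P := fun _ => False) (u := u) (v := v)
        (fun e => absurd (hu.symm.trans (e ▸ hv)) (by decide)) hu hv (by decide +kernel)
    have key : ∀ s ∈ coreQuads, s ≠ (3, 2, 1, 2) →
        (s.2.2.2, s.2.2.1, s.2.1, s.1) ∈ leftReducedQuads := by decide +kernel
    rw [hrev]
    exact key _ (hcore v) hne
  · have key : ∀ s ∈ coreQuads, s ≠ (2, 1, 2, 3) → s ∈ leftReducedQuads := by decide +kernel
    exact h.exists_typing_of_reduced hc hd hcd hn hdom
      fun v => key _ (hcore v) fun hv => hX' ⟨v, hv⟩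

end GoodGeodesic
end Setting

section Blowup

/-- The distance between distinct vertices of given types. -/
def typeDist : Fin 7 → Fin 7 → ℕ :=
  ![![1, 1, 1, 1, 1, 2, 2], ![1, 1, 1, 1, 2, 1, 1], ![1, 1, 1, 2, 2, 2, 2], ![1, 1, 2, 1, 2, 2, 2],
    ![1, 2, 2, 2, 1, 3, 3], ![2, 1, 2, 2, 3, 1, 2], ![2, 1, 2, 2, 3, 2, 1]]

theorem typeDist_of_not_typeAdj : ∀ s t p q : Fin 7, ¬ TypeAdj s t → p ≠ s → TypeAdj s p →
    q ≠ t → TypeAdj t q → (typeDist s t = 2 ∧ (TypeAdj p t ∨ TypeAdj s q)) ∨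
      (typeDist s t = 3 ∧ TypeAdj p q ∧ p ≠ q) := by
  decide +kernel

theorem typeDist_two_le : ∀ s t : Fin 7, TypeAdj s t ∧ typeDist s t = 1 ∨ ¬ TypeAdj s t ∧
    (typeDist s t = 2 ∨ typeDist s t = 3 ∧ ∀ p, TypeAdj s p → ¬ TypeAdj p t) := by
  decide +kernel

theorem TypeAdj.symm : ∀ {s t : Fin 7}, TypeAdj s t → TypeAdj t s := by
  decide +kernel

variable {V : Type*} {G : SimpleGraph V} {τ : V → Fin 7}

theorem IsTyping.exists_neighbor (h : IsTyping G τ) (hconn : G.Connected) {u v : V}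
    (huv : τ v ≠ τ u) : ∃ w, τ w ≠ τ u ∧ TypeAdj (τ u) (τ w) := by
  obtain ⟨p⟩ := hconn.preconnected u v
  obtain ⟨d, -, h1, h2⟩ := p.exists_boundary_dart {w | τ w = τ u} rfl huv
  rw [Set.mem_ofPred_eq] at h1 h2
  exact ⟨d.snd, h2, h1 ▸ ((h _ _).mp d.adj).2⟩

theorem IsTyping.dist_eq (h : IsTyping G τ) (hconn : G.Connected) {u v : V} (huv : u ≠ v) :
    G.dist u v = typeDist (τ u) (τ v) := by
  have hadj : G.Adj u v ↔ TypeAdj (τ u) (τ v) := by simp [h u v, huv]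
  have h0 : G.dist u v ≠ 0 := by rwa [ne_eq, hconn.dist_eq_zero_iff]
  rcases typeDist_two_le (τ u) (τ v) with ⟨h1, h2⟩ | ⟨h1, h2⟩
  · rw [h2]
    exact SimpleGraph.dist_eq_one_iff_adj.mpr (hadj.mpr h1)
  have h3 : G.dist u v ≠ 1 := by
    rw [ne_eq, SimpleGraph.dist_eq_one_iff_adj, hadj]
    exact h1
  have hne : τ v ≠ τ u := fun e => h1 (Or.inl e.symm)
  have hle : ∀ {w z : V}, TypeAdj (τ w) (τ z) → G.dist w z ≤ 1 := fun {w z} hwz => by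
    rcases eq_or_ne w z with rfl | hwz'
    · simp
    · exact (SimpleGraph.dist_eq_one_iff_adj.mpr ((h _ _).mpr ⟨hwz', hwz⟩)).le
  obtain ⟨p, hp, hup⟩ := h.exists_neighbor hconn hne
  obtain ⟨q, hq, hvq⟩ := h.exists_neighbor hconn hne.symm
  have t1 := hconn.dist_triangle (u := u) (v := p) (w := v)
  have t2 := hconn.dist_triangle (u := u) (v := q) (w := v)
  have t3 := hconn.dist_triangle (u := p) (v := q) (w := v)
  have l1 := hle hup
  have l2 := hle hvq.symm
  rcases typeDist_of_not_typeAdj _ _ _ _ h1 hp hup hq hvq with ⟨h4, h5 | h5⟩ | ⟨h4, h5, -⟩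
  · have := hle h5
    omega
  · have := hle h5
    omega
  · have l3 := hle h5
    have h6 : G.dist u v ≠ 2 := by
      intro h7
      obtain ⟨p, hp⟩ := hconn.exists_walk_length_eq_dist u v
      rw [h7] at hp
      have g1 := p.adj_getVert_succ (i := 0) (by omega)
      have g2 := p.adj_getVert_succ (i := 1) (by omega)
      have g3 : p.getVert 2 = v := by rw [← hp, p.getVert_length]
      rw [p.getVert_zero] at g1
      rw [g3] at g2
      rcases h2 with h2 | ⟨-, h2⟩
      · omega
      · exact h2 _ ((h _ _).mp g1).2 ((h _ _).mp g2).2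
    omega

end Blowup

section TypeForm

variable {V : Type*} [Fintype V]

/-- The sum of a function over the vertices of type `t`. -/
def typeSum (τ : V → Fin 7) (z : V → ℝ) (t : Fin 7) : ℝ :=
  ∑ u, if τ u = t then z u else 0

theorem sum_mul_type (τ : V → Fin 7) (z : V → ℝ) (g : Fin 7 → ℝ) :
    ∑ u, z u * g (τ u) = ∑ t, typeSum τ z t * g t := by
  simp only [typeSum, Finset.sum_mul]
  rw [Finset.sum_comm]
  simp

theorem sq_typeSum_le (τ : V → Fin 7) (z : V → ℝ) (t : Fin 7) {n : ℕ} (hn : typeCount τ t ≤ n) :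
    typeSum τ z t ^ 2 ≤ n * typeSum τ (fun u => z u ^ 2) t := by
  have h := sq_sum_le_card_mul_sum_sq (s := Finset.univ.filter fun v => τ v = t) (f := z)
  simp only [typeSum, ← Finset.sum_filter]
  refine h.trans (mul_le_mul_of_nonneg_right ?_ (Finset.sum_nonneg fun _ _ => sq_nonneg _))
  exact_mod_cast hn

theorem typeSum_sq_nonneg (τ : V → Fin 7) (z : V → ℝ) (t : Fin 7) :
    0 ≤ typeSum τ (fun u => z u ^ 2) t :=
  Finset.sum_nonneg fun u _ => by positivity

theorem eq_zero_of_sum_typeSum_sq {τ : V → Fin 7} {z : V → ℝ}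
    (h : ∑ t, typeSum τ (fun u => z u ^ 2) t ≤ 0) : z = 0 := by
  have h1 := sum_mul_type τ (fun u => z u ^ 2) fun _ => 1
  simp only [mul_one] at h1
  funext u
  have h2 := Finset.single_le_sum (f := fun u => z u ^ 2) (fun i _ => sq_nonneg _)
    (Finset.mem_univ u)
  have h3 : z u ^ 2 = 0 := le_antisymm (h2.trans (h1.trans_le h)) (sq_nonneg _)
  simpa using h3

variable [DecidableEq V] {G : SimpleGraph V} {τ : V → Fin 7}

theorem IsTyping.form_eq (h : IsTyping G τ) (hconn : G.Connected) (z : V → ℝ) :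
    z ⬝ᵥ shiftedDist G *ᵥ z =
      2 * ∑ s, typeSum τ z s * ∑ t, typeSum τ z t * (typeDist s t : ℝ) -
        ∑ t, typeSum τ (fun u => z u ^ 2) t := by
  have hdiag : ∀ t, typeDist t t = 1 := by decide
  have h1 : ∀ u v, shiftedDist G u v = 2 * (typeDist (τ u) (τ v) : ℝ) - if u = v then 1 else 0 := by
    intro u v
    rw [shiftedDist_apply]
    rcases eq_or_ne u v with rfl | huv
    · rw [hdiag]
      norm_num
    · simp [huv, h.dist_eq hconn huv]
  have h2 := sum_mul_type τ (fun u => z u ^ 2) fun _ => 1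
  simp only [mul_one] at h2
  have h3 : ∀ s, ∑ t, typeSum τ z t * (typeDist s t : ℝ) = ∑ v, z v * (typeDist s (τ v) : ℝ) :=
    fun s => (sum_mul_type τ z fun t => (typeDist s t : ℝ)).symm
  rw [← h2, ← sum_mul_type τ z fun s => ∑ t, typeSum τ z t * (typeDist s t : ℝ)]
  simp only [h3, dotProduct, mulVec, h1, Finset.mul_sum, sub_mul, Finset.sum_sub_distrib, mul_sub]
  congr 1
  · refine Finset.sum_congr rfl fun u _ => Finset.sum_congr rfl fun v _ => by ring
  · simp [sq]

/-- The coefficients of the linear form on whose kernel the form of a blow-up is definite. -/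
def typeCoeff : Fin 7 → ℝ := ![1, 2, 2, 2, 2, 4, 4]

theorem IsTyping.negDef_of_form (h : IsTyping G τ) (hconn : G.Connected)
    (H : ∀ z : V → ℝ, ∑ t, typeSum τ z t * typeCoeff t = 0 →
      ∑ t, typeSum τ (fun u => z u ^ 2) t ≤
        2 * ∑ s, typeSum τ z s * ∑ t, typeSum τ z t * (typeDist s t : ℝ) →
      ∑ t, typeSum τ (fun u => z u ^ 2) t ≤ 0) :
    NegDefOnHyperplane (shiftedDist G) := by
  refine ⟨fun u => typeCoeff (τ u), fun z hz hφ => ?_⟩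
  rw [h.form_eq hconn]
  by_contra! hge
  refine hz (eq_zero_of_sum_typeSum_sq (H z ?_ (by linarith)))
  rw [← sum_mul_type, ← hφ]
  exact Finset.sum_congr rfl fun u _ => mul_comm _ _

theorem sum_typeDist_form (Z : Fin 7 → ℝ) :
    2 * ∑ s, Z s * ∑ t, Z t * (typeDist s t : ℝ) =
      (∑ t, Z t * typeCoeff t) ^ 2 + Z 0 ^ 2 + Z 1 ^ 2 + Z 2 ^ 2 + Z 3 ^ 2 / 2 -
        3 * (Z 1 + 2 / 3 * Z 2 + 2 / 3 * Z 3 + 2 * Z 5 + 2 * Z 6) ^ 2 -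
        5 / 3 * (Z 2 - 4 / 5 * Z 3) ^ 2 - 1 / 10 * Z 3 ^ 2 - 2 * (Z 4 + Z 5 + Z 6) ^ 2  +
        4 * Z 5 * Z 6 := by
  simp [Fin.sum_univ_succ, typeCoeff, typeDist]
  ring

theorem IsTyping.negDef_pt1 (h : IsTyping G τ) (hconn : G.Connected)
    (hc : ∀ t, typeCount τ t ≤ pt1Size t) : NegDefOnHyperplane (shiftedDist G) := by
  refine h.negDef_of_form hconn fun z hφ hge => ?_
  have hs := fun t => sq_typeSum_le τ z t (hc t)
  generalize typeSum τ (fun u => z u ^ 2) = W at *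
  generalize typeSum τ z = Z at *
  have hQ := sum_typeDist_form Z
  rw [hφ] at hQ
  generalize 2 * ∑ s, Z s * ∑ t, Z t * (typeDist s t : ℝ) = Q at *
  simp only [Fin.sum_univ_seven] at hge ⊢
  have s0 : Z 0 ^ 2 ≤ W 0 := by simpa [pt1Size] using hs 0
  have s1 : Z 1 ^ 2 ≤ W 1 := by simpa [pt1Size] using hs 1
  have s2 : Z 2 ^ 2 ≤ W 2 := by simpa [pt1Size] using hs 2
  have s3 : Z 3 ^ 2 ≤ 2 * W 3 := by simpa [pt1Size] using hs 3
  have s4 : Z 4 ^ 2 ≤ W 4 := by simpa [pt1Size] using hs 4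
  have s5 : Z 5 ^ 2 ≤ W 5 := by simpa [pt1Size] using hs 5
  have s6 : Z 6 ^ 2 ≤ 2 * W 6 := by simpa [pt1Size] using hs 6
  have e1 : -2 * (Z 4 + Z 5 + Z 6) ^ 2 + 4 * Z 5 * Z 6 = Z 4 ^ 2 + Z 5 ^ 2 + Z 6 ^ 2 / 2 -
      3 * (Z 4 + 2 / 3 * Z 5 + 2 / 3 * Z 6) ^ 2 - 5 / 3 * (Z 5 - 4 / 5 * Z 6) ^ 2 -
      1 / 10 * Z 6 ^ 2 := by
    ring
  have n1 := sq_nonneg (Z 1 + 2 / 3 * Z 2 + 2 / 3 * Z 3 + 2 * Z 5 + 2 * Z 6)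
  have n2 := sq_nonneg (Z 2 - 4 / 5 * Z 3)
  have n3 := sq_nonneg (Z 3)
  have n4 := sq_nonneg (Z 4 + 2 / 3 * Z 5 + 2 / 3 * Z 6)
  have n5 := sq_nonneg (Z 5 - 4 / 5 * Z 6)
  have n6 := sq_nonneg (Z 6)
  have z3 : Z 3 = 0 := pow_eq_zero_iff two_ne_zero |>.mp (by linarith)
  have z6 : Z 6 = 0 := pow_eq_zero_iff two_ne_zero |>.mp (by linarith)
  have z2 : Z 2 - 4 / 5 * Z 3 = 0 := pow_eq_zero_iff two_ne_zero |>.mp (by linarith)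
  have z5 : Z 5 - 4 / 5 * Z 6 = 0 := pow_eq_zero_iff two_ne_zero |>.mp (by linarith)
  have z4 : Z 4 + 2 / 3 * Z 5 + 2 / 3 * Z 6 = 0 :=
    pow_eq_zero_iff two_ne_zero |>.mp (by linarith)
  have z1 : Z 1 + 2 / 3 * Z 2 + 2 / 3 * Z 3 + 2 * Z 5 + 2 * Z 6 = 0 :=
    pow_eq_zero_iff two_ne_zero |>.mp (by linarith)
  have z0 : Z 0 = 0 := by
    simp [Fin.sum_univ_seven, typeCoeff] at hφ
    linarith
  have y2 : Z 2 = 0 := by linarith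
  have y5 : Z 5 = 0 := by linarith
  have y4 : Z 4 = 0 := by linarith
  have y1 : Z 1 = 0 := by linarith
  simp only [z0, y1, y2, z3, y4, y5, z6] at hQ
  linarith

theorem IsTyping.negDef_pt2 (h : IsTyping G τ) (hconn : G.Connected) {p q : ℕ}
    (hc : ∀ t, typeCount τ t ≤ pt2Size p q t) : NegDefOnHyperplane (shiftedDist G) := by
  refine h.negDef_of_form hconn fun z hφ hge => ?_
  have hs := fun t => sq_typeSum_le τ z t (hc t)
  have hn := typeSum_sq_nonneg τ z
  generalize typeSum τ (fun u => z u ^ 2) = W at *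
  generalize typeSum τ z = Z at *
  have hQ := sum_typeDist_form Z
  rw [hφ] at hQ
  generalize 2 * ∑ s, Z s * ∑ t, Z t * (typeDist s t : ℝ) = Q at *
  simp only [Fin.sum_univ_seven] at hge ⊢
  have s0 : Z 0 ^ 2 ≤ W 0 := by simpa [pt2Size] using hs 0
  have s1 : Z 1 ^ 2 ≤ W 1 := by simpa [pt2Size] using hs 1
  have s2 : Z 2 ^ 2 ≤ W 2 := by simpa [pt2Size] using hs 2
  have s3 : Z 3 ^ 2 ≤ 2 * W 3 := by simpa [pt2Size] using hs 3
  have s4 : Z 4 ^ 2 ≤ (p - 1 : ℕ) * W 4 := by simpa [pt2Size] using hs 4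
  have z6 : Z 6 = 0 := by simpa [pt2Size] using hs 6
  have n1 := sq_nonneg (Z 1 + 2 / 3 * Z 2 + 2 / 3 * Z 3 + 2 * Z 5 + 2 * Z 6)
  have n2 := sq_nonneg (Z 2 - 4 / 5 * Z 3)
  have n3 := sq_nonneg (Z 3)
  have n4 := sq_nonneg (Z 4 + Z 5 + Z 6)
  have n5 : 4 * Z 5 * Z 6 = 0 := by simp [z6]
  have h4 := hn 4
  have h5 := hn 5
  have h6 := hn 6
  have w4 : W 4 = 0 := by linarith
  have z3 : Z 3 = 0 := pow_eq_zero_iff two_ne_zero |>.mp (by linarith)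
  have z4 : Z 4 = 0 := by simpa [w4] using s4
  have z2 : Z 2 - 4 / 5 * Z 3 = 0 := pow_eq_zero_iff two_ne_zero |>.mp (by linarith)
  have z5 : Z 4 + Z 5 + Z 6 = 0 := pow_eq_zero_iff two_ne_zero |>.mp (by linarith)
  have z1 : Z 1 + 2 / 3 * Z 2 + 2 / 3 * Z 3 + 2 * Z 5 + 2 * Z 6 = 0 :=
    pow_eq_zero_iff two_ne_zero |>.mp (by linarith)
  have z0 : Z 0 = 0 := by
    simp [Fin.sum_univ_seven, typeCoeff] at hφ
    linarith
  have y2 : Z 2 = 0 := by linarith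
  have y5 : Z 5 = 0 := by linarith
  have y1 : Z 1 = 0 := by linarith
  simp only [z0, y1, y2, z3, z4, y5, z6] at hQ
  linarith

end TypeForm

section Embedding

variable {V W : Type*} [Fintype V] [Fintype W] {G : SimpleGraph V} {H : SimpleGraph W}
  {σ : W → Fin 7}

theorem IsTyping.isoToConnectedInducedSubgraph_iff (hσ : IsTyping H σ) (hconn : G.Connected) :
    IsoToConnectedInducedSubgraph G H ↔
      ∃ τ, IsTyping G τ ∧ ∀ t, typeCount τ t ≤ typeCount σ t := by
  constructor
  · rintro ⟨s, -, ⟨e⟩⟩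
    have he : Function.Injective fun v => (e v : W) :=
      Subtype.val_injective.comp e.injective
    refine ⟨fun v => σ (e v), fun u v => ?_, fun t => ?_⟩
    · rw [← e.map_adj_iff, SimpleGraph.comap_adj, ← he.ne_iff]
      exact hσ _ _
    · exact Finset.card_le_card_of_injOn (fun v => (e v : W)) (fun v hv => by simpa using hv)
        he.injOn
  · rintro ⟨τ, hτ, hc⟩
    have hf : ∀ t, Nonempty ({v // τ v = t} ↪ {w // σ w = t}) := fun t => by
      rw [Function.Embedding.nonempty_iff_card_le]
      simpa [typeCount, Fintype.card_subtype] using hc t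
    let g : V → W := fun v => (hf (τ v)).some ⟨v, rfl⟩
    have hg : ∀ v, σ (g v) = τ v := fun v => ((hf (τ v)).some ⟨v, rfl⟩).2
    have hinj : Function.Injective g := by
      have key : ∀ t v (hv : τ v = t), g v = (hf t).some ⟨v, hv⟩ := by
        rintro t v rfl
        rfl
      intro u v huv
      have h1 : τ u = τ v := by rw [← hg, ← hg, huv]
      rw [key _ u h1, key _ v rfl] at huv
      exact congrArg Subtype.val ((hf (τ v)).some.injective (Subtype.ext huv))
    have e : G ≃g H.induce (Set.range g) :=
      { Equiv.ofInjective g hinj with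
        map_rel_iff' := fun {u v} => by
          simp only [SimpleGraph.comap_adj]
          change H.Adj (g u) (g v) ↔ _
          rw [hσ, hτ, hg, hg, hinj.ne_iff] }
    exact ⟨Set.range g, e.connected_iff.mp hconn, ⟨e⟩⟩

end Embedding

section Models

theorem isTyping_pt1Graph : IsTyping Pt1Graph ![0, 1, 2, 3, 3, 4, 5, 6, 6] := by
  intro u v
  simp only [Pt1Graph, SimpleGraph.fromRel_adj]
  revert u v
  decide +kernel

theorem typeCount_pt1Graph : ∀ t, typeCount ![0, 1, 2, 3, 3, 4, 5, 6, 6] t = pt1Size t := by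
  decide +kernel

/-- The types of the vertices of a triple block graph. -/
def pt2Type (p q : ℕ) : Fin 5 ⊕ (Fin (p - 1) ⊕ Fin (q - 1)) → Fin 7 :=
  Sum.elim ![0, 1, 2, 3, 3] (Sum.elim (fun _ => 4) fun _ => 5)

theorem isTyping_pt2Graph (p q : ℕ) : IsTyping (Pt2Graph p q) (pt2Type p q) := by
  intro u v
  simp only [Pt2Graph, SimpleGraph.fromRel_adj, pt2Type]
  refine and_congr_right fun huv => ?_
  rcases u with u | u | u <;> rcases v with v | v | v
  · have huv' : u ≠ v := fun e => huv (e ▸ rfl)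
    simp only [Sum.elim_inl]
    clear huv
    revert u v
    decide
  all_goals simp
  all_goals clear huv
  · revert u
    decide
  · revert u
    decide
  · revert v
    decide
  · decide
  · decide
  · revert v
    decide
  · decide
  · decide

theorem typeCount_pt2Type (p q : ℕ) (t : Fin 7) : typeCount (pt2Type p q) t = pt2Size p q t := by
  rw [typeCount, Finset.card_filter, Fintype.sum_sum_type, Fintype.sum_sum_type]
  simp only [pt2Type, Sum.elim_inl, Sum.elim_inr, Fin.sum_univ_five]
  fin_cases t <;> simp [pt2Size]

end Models

theorem exists_isGeodesic {V : Type*} {G : SimpleGraph V} (hconn : G.Connected) {x y : V}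
    (hxy : G.dist x y = 3) : ∃ a b, IsGeodesic G x a b y := by
  obtain ⟨p, hp⟩ := hconn.exists_walk_length_eq_dist x y
  rw [hxy] at hp
  have g0 : G.Adj (p.getVert 0) (p.getVert 1) := p.adj_getVert_succ (by omega)
  have g1 : G.Adj (p.getVert 1) (p.getVert 2) := p.adj_getVert_succ (by omega)
  have g2 : G.Adj (p.getVert 2) (p.getVert 3) := p.adj_getVert_succ (by omega)
  have g3 : p.getVert 3 = y := by rw [← hp, p.getVert_length]
  rw [p.getVert_zero] at g0
  rw [g3] at g2
  rw [← SimpleGraph.dist_eq_one_iff_adj] at g0 g1 g2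
  have t1 := hconn.dist_triangle (u := x) (v := p.getVert 1) (w := p.getVert 2)
  have t2 := hconn.dist_triangle (u := x) (v := p.getVert 2) (w := y)
  have t3 := hconn.dist_triangle (u := x) (v := p.getVert 1) (w := y)
  have t4 := hconn.dist_triangle (u := p.getVert 1) (v := p.getVert 2) (w := y)
  exact ⟨p.getVert 1, p.getVert 2, ⟨g0, g1, G.dist_comm.trans g2, by omega, by
    rw [G.dist_comm]
    omega, hxy⟩⟩

theorem graphDiam_eq_three {V : Type*} [Fintype V] [Nonempty V] {G : SimpleGraph V}
    (h : graphDiam G = 3) : (∃ x y, G.dist x y = 3) ∧ ∀ u v, G.dist u v ≤ 3 := by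
  constructor
  · obtain ⟨p, -, hp⟩ := Finset.exists_mem_eq_sup (Finset.univ : Finset (V × V))
      Finset.univ_nonempty fun p => G.dist p.1 p.2
    exact ⟨p.1, p.2, hp.symm.trans h⟩
  · intro u v
    rw [← h]
    exact Finset.le_sup (f := fun p : V × V => G.dist p.1 p.2) (Finset.mem_univ (u, v))

/-- A finite connected graph of diameter 3 that is not a block graph (not both
chordal and diamond-free) satisfies `λ₂ < -1/2` if and only if it is isomorphic to a
connected induced subgraph of `Pt_1` or of a triple block graph `Pt_2(p,q)`, `p,q ≥ 2`. -/
theorem stmt_19 {V : Type*} [Fintype V] [DecidableEq V] (G : SimpleGraph V)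
    (hconn : G.Connected) (hdiam : graphDiam G = 3)
    (hnotblock : ¬ (IsChordal G ∧ ¬ HasInducedSubgraph G diamondGraph)) :
    lambda2 G < -1/2 ↔
      (IsoToConnectedInducedSubgraph G Pt1Graph ∨
        ∃ p q : ℕ, 2 ≤ p ∧ 2 ≤ q ∧ IsoToConnectedInducedSubgraph G (Pt2Graph p q)) := by
  have := hconn.nonempty
  obtain ⟨⟨x, y, hxy⟩, hle⟩ := graphDiam_eq_three hdiam
  have hcard : 1 < Fintype.card V := Fintype.one_lt_card_iff.mpr ⟨x, y, by
    rintro rfl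
    simp at hxy⟩
  rw [lambda2_lt_iff G hcard, isTyping_pt1Graph.isoToConnectedInducedSubgraph_iff hconn]
  simp only [(isTyping_pt2Graph _ _).isoToConnectedInducedSubgraph_iff hconn, typeCount_pt1Graph,
    typeCount_pt2Type]
  constructor
  · intro hform
    obtain ⟨a, b, hgeod⟩ := exists_isGeodesic hconn hxy
    obtain ⟨τ, hτ, h | ⟨p, q, hp, hq, h⟩⟩ :=
      GoodGeodesic.exists_typing ⟨hconn, hform, hle, hgeod⟩ hnotblock
    · exact Or.inl ⟨τ, hτ, h⟩
    · exact Or.inr ⟨p, q, hp, hq, τ, hτ, h⟩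
  · rintro (⟨τ, hτ, h⟩ | ⟨p, q, -, -, τ, hτ, h⟩)
    · exact hτ.negDef_pt1 hconn h
    · exact hτ.negDef_pt2 hconn h
end
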